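/- arXiv:2112.05380 — 4 statements merged into one kernel-verified Lean document; each statement's English description precedes it below -/
import Mathlib

section
/- (Continuity of the bilinear form, bounded case.) Let Ω ⊆ ℝ³ be a bounded open set admitting a Poincaré constant C_Ω > 0, and let a₁, a₂, a₃ : Ω → ℝ be of class C^m with a_l and all partial derivatives of a_l of order ≤ m bounded on Ω. Then for every s ∈ ℍ there exists a constant C(s) > 0 such that for all u, v ∈ C_c^∞(Ω, ℂ⊗ℍ): |⟨Q_s(T) u, v⟩_{L²}| ≤ C(s) ‖u‖_{D^m} ‖v‖_{D^m}, where |·| on the left is the quaternionic modulus. -/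
noncomputable section

open MeasureTheory Finset

/-- The quaternions ℍ. -/
abbrev HQ : Type := Quaternion ℝ

/-- The complexified quaternions ℂ⊗ℍ, modelled as pairs (u₁, u₂) representing u₁ + i u₂. -/
abbrev CH : Type := HQ × HQ

/-- Euclidean three-space. -/
abbrev E3 : Type := EuclideanSpace ℝ (Fin 3)

/-- The imaginary units e₁, e₂, e₃ of ℍ. -/
def qe : Fin 3 → HQ := ![⟨0,1,0,0⟩, ⟨0,0,1,0⟩, ⟨0,0,0,1⟩]

/-- Multiplication by the complex imaginary unit i on ℂ⊗ℍ : (u₁,u₂) ↦ (−u₂,u₁). -/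
def Ci (u : CH) : CH := (-u.2, u.1)

/-- Left multiplication of an element of ℂ⊗ℍ by a quaternion. -/
def lmul (p : HQ) (u : CH) : CH := (p * u.1, p * u.2)

/-- Right multiplication of an element of ℂ⊗ℍ by a quaternion. -/
def rmul (u : CH) (p : HQ) : CH := (u.1 * p, u.2 * p)

/-- The ℍ-valued inner product ⟨u,v⟩ = conj(u₁)v₁ + conj(u₂)v₂ on ℂ⊗ℍ. -/
def qip (u v : CH) : HQ := star u.1 * v.1 + star u.2 * v.2

/-- The squared modulus |u|² = |u₁|² + |u₂|² on ℂ⊗ℍ. -/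
def qmodSq (u : CH) : ℝ := ‖u.1‖ ^ 2 + ‖u.2‖ ^ 2

/-- Partial derivative within Ω in the l-th coordinate direction (ℂ⊗ℍ-valued). -/
def pdW (Ω : Set E3) (l : Fin 3) (f : E3 → CH) : E3 → CH :=
  fun x => fderivWithin ℝ f Ω x (EuclideanSpace.single l 1)

/-- Partial derivative within Ω in the l-th coordinate direction (real-valued). -/
def pdWR (Ω : Set E3) (l : Fin 3) (f : E3 → ℝ) : E3 → ℝ :=
  fun x => fderivWithin ℝ f Ω x (EuclideanSpace.single l 1)

/-- Mixed partial derivative ∂^b within Ω, for a multi-index b ∈ ℕ³ (ℂ⊗ℍ-valued). -/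
def pdMulti (Ω : Set E3) (b : Fin 3 → ℕ) (u : E3 → CH) : E3 → CH :=
  (pdW Ω 0)^[b 0] ((pdW Ω 1)^[b 1] ((pdW Ω 2)^[b 2] u))

/-- Mixed partial derivative ∂^b within Ω, for a multi-index b ∈ ℕ³ (real-valued). -/
def pdMultiR (Ω : Set E3) (b : Fin 3 → ℕ) (u : E3 → ℝ) : E3 → ℝ :=
  (pdWR Ω 0)^[b 0] ((pdWR Ω 1)^[b 1] ((pdWR Ω 2)^[b 2] u))

/-- The operator T u = i^{m−1}(a₁ e₁ ∂₁^m u + a₂ e₂ ∂₂^m u + a₃ e₃ ∂₃^m u). -/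
def Tq (Ω : Set E3) (m : ℕ) (a : Fin 3 → E3 → ℝ) (u : E3 → CH) : E3 → CH :=
  fun x => Ci^[m-1] (∑ l : Fin 3, a l x • lmul (qe l) ((pdW Ω l)^[m] u x))

/-- The operator Q_s(T) u = T(T u) − 2 Re(s) T u + |s|² u. -/
def Qq (Ω : Set E3) (m : ℕ) (a : Fin 3 → E3 → ℝ) (s : HQ) (u : E3 → CH) : E3 → CH :=
  fun x => Tq Ω m a (Tq Ω m a u) x - (2 * s.re) • Tq Ω m a u x + ‖s‖ ^ 2 • u x

/-- The ℍ-valued L² pairing ⟨u,v⟩_{L²} = ∫_Ω ⟨u(x),v(x)⟩ dx. -/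
def qL2ip (Ω : Set E3) (u v : E3 → CH) : HQ := ∫ x in Ω, qip (u x) (v x)

/-- Squared L² norm ‖u‖²_{L²} = ∫_Ω |u(x)|² dx. -/
def L2nsq (Ω : Set E3) (u : E3 → CH) : ℝ := ∫ x in Ω, qmodSq (u x)

/-- Squared L² norm for real-valued functions. -/
def L2nsqR (Ω : Set E3) (u : E3 → ℝ) : ℝ := ∫ x in Ω, (u x) ^ 2

/-- Squared D^m seminorm ‖u‖²_{D^m} = Σ_l ‖∂_{x_l}^m u‖²_{L²}. -/
def DmNsq (Ω : Set E3) (m : ℕ) (u : E3 → CH) : ℝ :=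
  ∑ l : Fin 3, L2nsq Ω ((pdW Ω l)^[m] u)

/-- Squared D^m seminorm for real-valued functions. -/
def DmNsqR (Ω : Set E3) (m : ℕ) (u : E3 → ℝ) : ℝ :=
  ∑ l : Fin 3, L2nsqR Ω ((pdWR Ω l)^[m] u)

/-- The finite set of multi-indices b ∈ ℕ³ with |b| ≤ m. -/
def multiIdxLe (m : ℕ) : Finset (Fin 3 → ℕ) :=
  (Fintype.piFinset fun _ : Fin 3 => Finset.range (m+1)).filter (fun b => b 0 + b 1 + b 2 ≤ m)

/-- The finite set of multi-indices b ∈ ℕ³ with |b| = m. -/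
def multiIdxEq (m : ℕ) : Finset (Fin 3 → ℕ) :=
  (Fintype.piFinset fun _ : Fin 3 => Finset.range (m+1)).filter (fun b => b 0 + b 1 + b 2 = m)

/-- Squared H^m norm ‖u‖²_{H^m} = Σ_{|b| ≤ m} ‖∂^b u‖²_{L²}. -/
def HmNsq (Ω : Set E3) (m : ℕ) (u : E3 → CH) : ℝ :=
  ∑ b ∈ multiIdxLe m, L2nsq Ω (pdMulti Ω b u)

/-- Squared H^m norm for real-valued functions. -/
def HmNsqR (Ω : Set E3) (m : ℕ) (u : E3 → ℝ) : ℝ :=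
  ∑ b ∈ multiIdxLe m, L2nsqR Ω (pdMultiR Ω b u)

/-- u ∈ C_c^∞(Ω, ℂ⊗ℍ). -/
def IsTestFun (Ω : Set E3) (u : E3 → CH) : Prop :=
  ContDiff ℝ (⊤ : ℕ∞) u ∧ HasCompactSupport u ∧ tsupport u ⊆ Ω

/-- u ∈ C_c^∞(Ω, ℝ). -/
def IsTestFunR (Ω : Set E3) (u : E3 → ℝ) : Prop :=
  ContDiff ℝ (⊤ : ℕ∞) u ∧ HasCompactSupport u ∧ tsupport u ⊆ Ω

/-- C is a Poincaré constant for Ω : ‖v‖_{L²} ≤ C ‖∇v‖_{L²} for all real test functions. -/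
def IsPoincareConst (Ω : Set E3) (C : ℝ) : Prop :=
  ∀ v : E3 → ℝ, IsTestFunR Ω v →
    Real.sqrt (∫ x in Ω, (v x) ^ 2) ≤ C * Real.sqrt (∫ x in Ω, ‖gradient v x‖ ^ 2)

/-- The coefficients a₁, a₂, a₃ are of class C^m on Ω, with a_l and all partial
derivatives of a_l of order ≤ m bounded on Ω. -/
def GoodCoeff (Ω : Set E3) (m : ℕ) (a : Fin 3 → E3 → ℝ) : Prop :=
  ∀ l : Fin 3, ContDiffOn ℝ m (a l) Ω ∧
    ∀ b ∈ multiIdxLe m, ∃ B : ℝ, ∀ x ∈ Ω, |pdMultiR Ω b (a l) x| ≤ B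

/-- Ω has property (R) with respect to the point P ∉ closure(Ω) : every ray from P
meets Ω in either the empty set or an open half-line. -/
def HasPropertyR (Ω : Set E3) (P : E3) : Prop :=
  P ∉ closure Ω ∧
    ∀ ω : E3, ‖ω‖ = 1 →
      (∀ r : ℝ, 0 ≤ r → P + r • ω ∉ Ω) ∨
      (∃ r₀ : ℝ, 0 ≤ r₀ ∧ ∀ r : ℝ, 0 ≤ r → (P + r • ω ∈ Ω ↔ r₀ < r))

/-- φ is a weight function for Ω with rate of exponential decay lam relative to P :
φ ∈ C¹(Ω) is bounded and positive, and (d/dr)[r²φ(P+rω)] ≤ −lam·r²φ(P+rω) along every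
ray from P. -/
def IsWeightFun (Ω : Set E3) (P : E3) (φ : E3 → ℝ) (lam : ℝ) : Prop :=
  ContDiffOn ℝ 1 φ Ω ∧ (∃ B : ℝ, ∀ x ∈ Ω, φ x ≤ B) ∧ (∀ x ∈ Ω, 0 < φ x) ∧
    ∀ ω : E3, ‖ω‖ = 1 → ∀ r : ℝ, 0 < r → P + r • ω ∈ Ω →
      deriv (fun t : ℝ => t ^ 2 * φ (P + t • ω)) r ≤ -lam * (r ^ 2 * φ (P + r • ω))

section CompactlySupported

open Set

variable {F : Type*} [NormedAddCommGroup F] [NormedSpace ℝ F]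

/-- The partial derivative in the `l`-th coordinate direction of a function on the whole space. -/
def partialD (l : Fin 3) (f : E3 → F) : E3 → F :=
  fun x => fderiv ℝ f x (EuclideanSpace.single l 1)

/-- `f` is a `C^n` function on `ℝ³` whose support is a compact subset of `Ω`. -/
structure IsCompactlyCn (Ω : Set E3) (n : ℕ) (f : E3 → F) : Prop where
  contDiff : ContDiff ℝ n f
  hasCompactSupport : HasCompactSupport f
  tsupport_subset : tsupport f ⊆ Ω

/-- The squared `L²` norm over the whole space. -/
def sqNorm {F : Type*} [NormedAddCommGroup F] (f : E3 → F) : ℝ := ∫ x, ‖f x‖ ^ 2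

lemma sqNorm_nonneg {F : Type*} [NormedAddCommGroup F] (f : E3 → F) : 0 ≤ sqNorm f :=
  integral_nonneg fun _ => by positivity

namespace IsCompactlyCn

variable {Ω : Set E3} {n k : ℕ} {f g : E3 → F}

lemma of_le (hf : IsCompactlyCn Ω n f) (h : k ≤ n) : IsCompactlyCn Ω k f :=
  ⟨hf.contDiff.of_le (by exact_mod_cast h), hf.hasCompactSupport, hf.tsupport_subset⟩

lemma eq_zero (hf : IsCompactlyCn Ω n f) {x : E3} (hx : x ∉ Ω) : f x = 0 :=
  image_eq_zero_of_notMem_tsupport fun h => hx (hf.tsupport_subset h)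

lemma continuous (hf : IsCompactlyCn Ω n f) : Continuous f := hf.contDiff.continuous

lemma add (hf : IsCompactlyCn Ω n f) (hg : IsCompactlyCn Ω n g) :
    IsCompactlyCn Ω n (fun x => f x + g x) :=
  ⟨hf.contDiff.add hg.contDiff, hf.hasCompactSupport.add hg.hasCompactSupport,
    (tsupport_add f g).trans (union_subset hf.tsupport_subset hg.tsupport_subset)⟩

lemma clm_comp {G : Type*} [NormedAddCommGroup G] [NormedSpace ℝ G] (L : F →L[ℝ] G)
    (hf : IsCompactlyCn Ω n f) : IsCompactlyCn Ω n (fun x => L (f x)) :=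
  ⟨L.contDiff.comp hf.contDiff, hf.hasCompactSupport.comp_left (map_zero L),
    (tsupport_comp_subset (map_zero L) f).trans hf.tsupport_subset⟩

lemma sum {ι : Type*} (s : Finset ι) {f : ι → E3 → F} (hf : ∀ i ∈ s, IsCompactlyCn Ω n (f i)) :
    IsCompactlyCn Ω n (fun x => ∑ i ∈ s, f i x) := by
  classical
  induction s using Finset.induction_on with
  | empty =>
    exact ⟨by simpa using contDiff_const, by simp [HasCompactSupport, tsupport],
      by simp [tsupport]⟩
  | insert i s hi ih =>
    simp only [Finset.sum_insert hi]
    exact (hf i (Finset.mem_insert_self i s)).add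
      (ih fun j hj => hf j (Finset.mem_insert_of_mem hj))

lemma smul (hΩ : IsOpen Ω) {a : E3 → ℝ} (ha : ContDiffOn ℝ n a Ω) (hf : IsCompactlyCn Ω n f) :
    IsCompactlyCn Ω n (fun x => a x • f x) := by
  have hs : tsupport (fun x => a x • f x) ⊆ tsupport f := tsupport_smul_subset_right a f
  refine ⟨contDiff_iff_contDiffAt.2 fun x => ?_, hf.hasCompactSupport.smul_left,
    hs.trans hf.tsupport_subset⟩
  by_cases hx : x ∈ Ω
  · exact (ha.contDiffAt (hΩ.mem_nhds hx)).smul hf.contDiff.contDiffAt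
  · have h0 : (fun x => a x • f x) =ᶠ[nhds x] 0 :=
      notMem_tsupport_iff_eventuallyEq.1 fun h => hx (hf.tsupport_subset (hs h))
    exact contDiffAt_const.congr_of_eventuallyEq h0

lemma partialD (l : Fin 3) (hf : IsCompactlyCn Ω (n + 1) f) :
    IsCompactlyCn Ω n (partialD l f) :=
  ⟨(hf.contDiff.fderiv_right (m := n) (by norm_cast)).clm_apply contDiff_const,
    hf.hasCompactSupport.fderiv_apply ℝ _,
    (tsupport_fderiv_apply_subset ℝ _).trans hf.tsupport_subset⟩

lemma iterate_partialD (l : Fin 3) (k : ℕ) :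
    ∀ {f : E3 → F}, IsCompactlyCn Ω (n + k) f → IsCompactlyCn Ω n ((_root_.partialD l)^[k] f) := by
  induction k with
  | zero => exact fun hf => hf
  | succ k ih => exact fun hf => ih (IsCompactlyCn.partialD l hf)

lemma integrable_sq (hf : IsCompactlyCn Ω n f) : Integrable (fun x => ‖f x‖ ^ 2) := by
  refine Continuous.integrable_of_hasCompactSupport (hf.continuous.norm.pow 2) ?_
  exact hf.hasCompactSupport.mono fun x hx h0 => hx (by simp [h0])

lemma integrable_clm₂ {G H : Type*} [NormedAddCommGroup G] [NormedSpace ℝ G]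
    [NormedAddCommGroup H] [NormedSpace ℝ H] (B : F →L[ℝ] G →L[ℝ] H) {g : E3 → G}
    (hf : IsCompactlyCn Ω n f) (hg : Continuous g) :
    Integrable (fun x => B (f x) (g x)) := by
  refine Continuous.integrable_of_hasCompactSupport
    ((B.continuous.comp hf.continuous).clm_apply hg) ?_
  exact hf.hasCompactSupport.mono fun x hx h0 => hx (by simp [h0])

end IsCompactlyCn

variable {Ω : Set E3} {n k : ℕ} {f g : E3 → F}

lemma iterate_partialD_add (l : Fin 3) (k : ℕ) : ∀ {f g : E3 → F}, ContDiff ℝ k f → ContDiff ℝ k g →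
    (partialD l)^[k] (fun x => f x + g x) =
      fun x => (partialD l)^[k] f x + (partialD l)^[k] g x := by
  induction k with
  | zero => intros; rfl
  | succ k ih =>
    intro f g hf hg
    have h1 : partialD l (fun x => f x + g x) = fun x => partialD l f x + partialD l g x := by
      funext x
      simp only [partialD]
      rw [fderiv_fun_add (hf.differentiable (by simp) x) (hg.differentiable (by simp) x)]
      rfl
    have hd : ∀ {h : E3 → F}, ContDiff ℝ (k + 1 : ℕ) h → ContDiff ℝ k (partialD l h) := fun hh =>
      (hh.fderiv_right (m := k) (by norm_cast)).clm_apply contDiff_const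
    simp only [Function.iterate_succ_apply, h1]
    exact ih (hd hf) (hd hg)

lemma sqNorm_add_le (hf : IsCompactlyCn Ω n f) (hg : IsCompactlyCn Ω n g) :
    sqNorm (fun x => f x + g x) ≤ 2 * sqNorm f + 2 * sqNorm g := by
  simp only [sqNorm]
  rw [← integral_const_mul, ← integral_const_mul,
    ← integral_add (hf.integrable_sq.const_mul 2) (hg.integrable_sq.const_mul 2)]
  refine integral_mono (hf.add hg).integrable_sq
    ((hf.integrable_sq.const_mul 2).add (hg.integrable_sq.const_mul 2)) fun x => ?_
  have h := norm_add_le (f x) (g x)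
  have h0 := norm_nonneg (f x + g x)
  simp only
  nlinarith [sq_nonneg (‖f x‖ - ‖g x‖)]

lemma sqNorm_le_of_norm_le {G : Type*} [NormedAddCommGroup G] [NormedSpace ℝ G] {g : E3 → G}
    (hf : IsCompactlyCn Ω n f) (hg : IsCompactlyCn Ω n g)
    {B : ℝ} (h : ∀ x ∈ Ω, ‖g x‖ ≤ B * ‖f x‖) : sqNorm g ≤ B ^ 2 * sqNorm f := by
  simp only [sqNorm]
  rw [← integral_const_mul]
  refine integral_mono hg.integrable_sq (hf.integrable_sq.const_mul _) fun x => ?_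
  by_cases hx : x ∈ Ω
  · simp only
    rw [← mul_pow]
    exact pow_le_pow_left₀ (norm_nonneg _) (h x hx) 2
  · simp [hf.eq_zero hx, hg.eq_zero hx]

/-- Integration by parts `k` times, for compactly supported functions. -/
lemma integral_clm₂_iterate_partialD {G H : Type*} [NormedAddCommGroup G] [NormedSpace ℝ G]
    [NormedAddCommGroup H] [NormedSpace ℝ H] (B : F →L[ℝ] G →L[ℝ] H) (l : Fin 3) (k : ℕ) :
    ∀ {f : E3 → F} {g : E3 → G}, IsCompactlyCn Ω k f → IsCompactlyCn Ω k g →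
      ∫ x, B ((partialD l)^[k] f x) (g x) = (-1 : ℝ) ^ k • ∫ x, B (f x) ((partialD l)^[k] g x) := by
  induction k with
  | zero => intros; simp
  | succ k ih =>
    intro f g hf hg
    have hDg : IsCompactlyCn Ω 1 ((partialD l)^[k] g) :=
      IsCompactlyCn.iterate_partialD l k (by rwa [add_comm])
    have hparts : ∫ x, B (f x) (partialD l ((partialD l)^[k] g) x) =
        - ∫ x, B (partialD l f x) ((partialD l)^[k] g x) :=
      integral_bilinear_fderiv_right_eq_neg_left_of_integrable
        ((hf.partialD l).integrable_clm₂ B hDg.continuous)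
        (hf.integrable_clm₂ B (IsCompactlyCn.partialD (n := 0) l hDg).continuous)
        (hf.integrable_clm₂ B hDg.continuous)
        (fun x _ => hf.contDiff.differentiable (by simp) x)
        (fun x _ => hDg.contDiff.differentiable (by simp) x)
    rw [Function.iterate_succ_apply, ih (hf.partialD l) (hg.of_le k.le_succ),
      Function.iterate_succ_apply', hparts, pow_succ]
    simp

/-- The Cauchy–Schwarz inequality for a bounded bilinear pairing. -/
lemma exists_norm_integral_clm₂_le {G H : Type*} [NormedAddCommGroup G] [NormedSpace ℝ G]
    [NormedAddCommGroup H] [NormedSpace ℝ H] (Ω : Set E3) (B : F →L[ℝ] G →L[ℝ] H) :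
    ∃ c : ℝ, 0 ≤ c ∧ ∀ (n k : ℕ) (f : E3 → F) (g : E3 → G), IsCompactlyCn Ω n f →
      IsCompactlyCn Ω k g → ‖∫ x, B (f x) (g x)‖ ≤ c * (√(sqNorm f) * √(sqNorm g)) := by
  refine ⟨‖B‖, norm_nonneg B, fun n k f g hf hg => ?_⟩
  have hLf : MemLp (fun x => ‖f x‖) (ENNReal.ofReal 2) :=
    (hf.continuous.memLp_of_hasCompactSupport hf.hasCompactSupport).norm
  have hLg : MemLp (fun x => ‖g x‖) (ENNReal.ofReal 2) :=
    (hg.continuous.memLp_of_hasCompactSupport hg.hasCompactSupport).norm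
  have hcs := integral_mul_le_Lp_mul_Lq_of_nonneg Real.HolderConjugate.two_two
    (ae_of_all volume fun x => norm_nonneg (f x)) (ae_of_all volume fun x => norm_nonneg (g x))
    hLf hLg
  simp only [Real.rpow_ofNat, ← Real.sqrt_eq_rpow] at hcs
  have hint : Integrable (fun x => ‖f x‖ * ‖g x‖) := by
    refine Continuous.integrable_of_hasCompactSupport
      (hf.continuous.norm.mul hg.continuous.norm) ?_
    exact hf.hasCompactSupport.mono fun x hx h0 => hx (by simp [h0])
  calc ‖∫ x, B (f x) (g x)‖ ≤ ∫ x, ‖B‖ * (‖f x‖ * ‖g x‖) :=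
        norm_integral_le_of_norm_le (hint.const_mul _) <| ae_of_all _ fun x => by
          rw [← mul_assoc]; exact B.le_opNorm₂ _ _
    _ = ‖B‖ * ∫ x, ‖f x‖ * ‖g x‖ := integral_const_mul _ _
    _ ≤ _ := mul_le_mul_of_nonneg_left hcs (norm_nonneg B)

/-- The Poincaré inequality in a coordinate direction along which `Ω` is bounded. -/
lemma sqNorm_le_partialD_of_inner {F : Type*} [NormedAddCommGroup F] [InnerProductSpace ℝ F]
    {f : E3 → F} {R : ℝ} (hR : ∀ x ∈ Ω, ‖x‖ ≤ R) (l : Fin 3) (hf : IsCompactlyCn Ω 1 f) :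
    sqNorm f ≤ 4 * R ^ 2 * sqNorm (partialD l f) := by
  have hf' : IsCompactlyCn Ω 0 (partialD l f) := hf.partialD l
  have hd : Differentiable ℝ f := hf.contDiff.differentiable (by simp)
  have hsq : ∀ x, fderiv ℝ (fun x => ‖f x‖ ^ 2) x (EuclideanSpace.single l 1) =
      2 * inner ℝ (f x) (partialD l f x) := fun x => by
    rw [((hd x).hasFDerivAt.norm_sq).fderiv]
    simp [partialD]
  have hproj : ∀ x : E3, fderiv ℝ (fun x : E3 => x l) x (EuclideanSpace.single l 1) = 1 :=
    fun x => by
      have h := (EuclideanSpace.proj l : E3 →L[ℝ] ℝ).hasFDerivAt (x := x)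
      rw [HasFDerivAt.fderiv (f := fun x : E3 => x l) h]
      simp
  have hcoord : Continuous fun x : E3 => x l :=
    (EuclideanSpace.proj l : E3 →L[ℝ] ℝ).continuous
  have hint : Integrable (fun x : E3 => 2 * inner ℝ (f x) (partialD l f x) * x l) := by
    refine Continuous.integrable_of_hasCompactSupport
      ((continuous_const.mul (hf.continuous.inner hf'.continuous)).mul hcoord) ?_
    exact hf.hasCompactSupport.mono fun x hx h0 => hx (by simp [h0])
  have hparts := integral_mul_fderiv_eq_neg_fderiv_mul_of_integrable (μ := volume)
    (f := fun x : E3 => ‖f x‖ ^ 2) (g := fun x : E3 => x l) (v := EuclideanSpace.single l 1)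
    (by simpa only [hsq] using hint)
    (by simpa only [hproj, mul_one] using hf.integrable_sq)
    (by
      refine Continuous.integrable_of_hasCompactSupport
        ((hf.continuous.norm.pow 2).mul hcoord) ?_
      exact hf.hasCompactSupport.mono fun x hx h0 => hx (by simp [h0]))
    (fun x _ => (hd x).norm_sq ℝ)
    (fun x _ => (EuclideanSpace.proj l : E3 →L[ℝ] ℝ).differentiableAt)
  simp only [hsq, hproj, mul_one] at hparts
  have hbound : sqNorm f ≤ (1 / 2) * sqNorm f + 2 * R ^ 2 * sqNorm (partialD l f) := by
    calc sqNorm f = ∫ x, -(2 * inner ℝ (f x) (partialD l f x) * x l) := by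
          rw [integral_neg]; exact hparts
      _ ≤ ∫ x, ((1 / 2) * ‖f x‖ ^ 2 + 2 * R ^ 2 * ‖partialD l f x‖ ^ 2) := by
          refine integral_mono hint.neg
            ((hf.integrable_sq.const_mul _).add (hf'.integrable_sq.const_mul _)) fun x => ?_
          by_cases hx : x ∈ Ω
          · have h1 : |x l| ≤ R :=
              (by simpa using PiLp.norm_apply_le x l : |x l| ≤ ‖x‖).trans (hR x hx)
            have h2 := abs_real_inner_le_norm (f x) (partialD l f x)
            have h3 : |inner ℝ (f x) (partialD l f x) * x l| ≤ ‖f x‖ * ‖partialD l f x‖ * R := by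
              rw [abs_mul]; gcongr
            have h4 := neg_abs_le (inner ℝ (f x) (partialD l f x) * x l)
            simp only
            nlinarith [sq_nonneg (‖f x‖ - 2 * R * ‖partialD l f x‖)]
          · simp [hf.eq_zero hx, hf'.eq_zero hx]
      _ = _ := by
          rw [integral_add (hf.integrable_sq.const_mul _) (hf'.integrable_sq.const_mul _),
            integral_const_mul, integral_const_mul]
          rfl
  linarith

lemma partialD_clm_comp {G : Type*} [NormedAddCommGroup G] [NormedSpace ℝ G] (L : F →L[ℝ] G)
    (l : Fin 3) (hf : Differentiable ℝ f) :
    partialD l (fun x => L (f x)) = fun x => L (partialD l f x) := by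
  funext x
  simp only [partialD]
  rw [HasFDerivAt.fderiv (f := fun x => L (f x)) (L.hasFDerivAt.comp x (hf x).hasFDerivAt)]
  rfl

lemma sqNorm_le_partialD {f : E3 → CH} {R : ℝ} (hR : ∀ x ∈ Ω, ‖x‖ ≤ R) (l : Fin 3)
    (hf : IsCompactlyCn Ω 1 f) : sqNorm f ≤ 8 * R ^ 2 * sqNorm (partialD l f) := by
  have hd : Differentiable ℝ f := hf.contDiff.differentiable (by simp)
  have hf' : IsCompactlyCn Ω 0 (partialD l f) := hf.partialD l
  have h₁ := hf.clm_comp (ContinuousLinearMap.fst ℝ HQ HQ)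
  have h₂ := hf.clm_comp (ContinuousLinearMap.snd ℝ HQ HQ)
  have p₁ := sqNorm_le_partialD_of_inner hR l h₁
  have p₂ := sqNorm_le_partialD_of_inner hR l h₂
  rw [partialD_clm_comp _ l hd] at p₁ p₂
  have q₁ := sqNorm_le_of_norm_le (B := 1) hf' (hf'.clm_comp (ContinuousLinearMap.fst ℝ HQ HQ))
    fun x _ => by simpa using norm_fst_le (partialD l f x)
  have q₂ := sqNorm_le_of_norm_le (B := 1) hf' (hf'.clm_comp (ContinuousLinearMap.snd ℝ HQ HQ))
    fun x _ => by simpa using norm_snd_le (partialD l f x)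
  have hsum : sqNorm f ≤ sqNorm (fun x => ContinuousLinearMap.fst ℝ HQ HQ (f x)) +
      sqNorm (fun x => ContinuousLinearMap.snd ℝ HQ HQ (f x)) := by
    simp only [sqNorm]
    rw [← integral_add h₁.integrable_sq h₂.integrable_sq]
    refine integral_mono hf.integrable_sq (h₁.integrable_sq.add h₂.integrable_sq) fun x => ?_
    simp only [ContinuousLinearMap.coe_fst', ContinuousLinearMap.coe_snd', Prod.norm_def]
    rcases max_cases ‖(f x).1‖ ‖(f x).2‖ with h | h <;> rw [h.1] <;>
      nlinarith [sq_nonneg ‖(f x).1‖, sq_nonneg ‖(f x).2‖]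
  nlinarith [sq_nonneg R]

lemma sqNorm_le_iterate_partialD {R : ℝ} (hR : ∀ x ∈ Ω, ‖x‖ ≤ R) (l : Fin 3) (k : ℕ) :
    ∀ {f : E3 → CH}, IsCompactlyCn Ω k f →
      sqNorm f ≤ (8 * R ^ 2) ^ k * sqNorm ((partialD l)^[k] f) := by
  induction k with
  | zero => intros; simp
  | succ k ih =>
    intro f hf
    calc sqNorm f ≤ 8 * R ^ 2 * sqNorm (partialD l f) :=
          sqNorm_le_partialD hR l (hf.of_le (by lia))
      _ ≤ 8 * R ^ 2 * ((8 * R ^ 2) ^ k * sqNorm ((partialD l)^[k] (partialD l f))) := by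
          gcongr
          exact ih (hf.partialD l)
      _ = _ := by rw [Function.iterate_succ_apply]; ring

lemma partialD_smul (hΩ : IsOpen Ω) {a : E3 → ℝ} (ha : ContDiffOn ℝ 1 a Ω) (l : Fin 3)
    (hf : IsCompactlyCn Ω 1 f) :
    partialD l (fun x => a x • f x) = fun x => pdWR Ω l a x • f x + a x • partialD l f x := by
  have haf : IsCompactlyCn Ω 1 (fun x => a x • f x) := IsCompactlyCn.smul hΩ (mod_cast ha) hf
  funext x
  by_cases hx : x ∈ Ω
  · have hax : DifferentiableAt ℝ a x :=
      (ha.contDiffAt (hΩ.mem_nhds hx)).differentiableAt (by simp)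
    simp only [partialD, pdWR, fderivWithin_of_isOpen hΩ hx]
    rw [fderiv_fun_smul hax (hf.contDiff.differentiable (by simp) x)]
    simp [add_comm]
  · rw [(IsCompactlyCn.partialD (n := 0) l haf).eq_zero hx, hf.eq_zero hx,
      (IsCompactlyCn.partialD (n := 0) l hf).eq_zero hx]
    simp

/-- Multiplication by a coefficient with bounded derivatives is bounded for the seminorm
`f ↦ ‖∂_l^k f‖_{L²}`. -/
lemma exists_sqNorm_iterate_partialD_smul_le (hΩ : IsOpen Ω) {R : ℝ} (hR : ∀ x ∈ Ω, ‖x‖ ≤ R)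
    (l : Fin 3) (k : ℕ) : ∀ {a : E3 → ℝ}, ContDiffOn ℝ k a Ω →
      (∀ j ≤ k, ∃ B : ℝ, ∀ x ∈ Ω, |(pdWR Ω l)^[j] a x| ≤ B) →
      ∃ K : ℝ, 0 ≤ K ∧ ∀ f : E3 → CH, IsCompactlyCn Ω k f →
        sqNorm ((partialD l)^[k] (fun x => a x • f x)) ≤ K * sqNorm ((partialD l)^[k] f) := by
  induction k with
  | zero =>
    intro a ha hB
    obtain ⟨B, hB⟩ := hB 0 le_rfl
    refine ⟨B ^ 2, sq_nonneg B, fun f hf => sqNorm_le_of_norm_le hf (hf.smul hΩ ha) fun x hx => ?_⟩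
    rw [norm_smul, Real.norm_eq_abs]
    exact mul_le_mul_of_nonneg_right (hB x hx) (norm_nonneg _)
  | succ k ih =>
    intro a ha hB
    have ha' : ContDiffOn ℝ k (pdWR Ω l a) Ω :=
      (ha.fderivWithin hΩ.uniqueDiffOn (m := k) (by norm_cast)).clm_apply contDiffOn_const
    have hak : ContDiffOn ℝ k a Ω := ha.of_le (by norm_cast; lia)
    obtain ⟨K₁, hK₁, h₁⟩ := ih ha' fun j hj => hB (j + 1) (by lia)
    obtain ⟨K₂, hK₂, h₂⟩ := ih hak fun j hj => hB j (by lia)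
    refine ⟨2 * (K₁ * (8 * R ^ 2)) + 2 * K₂, by positivity, fun f hf => ?_⟩
    have hfk : IsCompactlyCn Ω k f := hf.of_le k.le_succ
    have c₁ : IsCompactlyCn Ω k (fun x => pdWR Ω l a x • f x) := hfk.smul hΩ ha'
    have c₂ : IsCompactlyCn Ω k (fun x => a x • partialD l f x) := (hf.partialD l).smul hΩ hak
    have hp : sqNorm ((partialD l)^[k] f) ≤ 8 * R ^ 2 * sqNorm ((partialD l)^[k + 1] f) := by
      rw [Function.iterate_succ_apply']
      exact sqNorm_le_partialD hR l (IsCompactlyCn.iterate_partialD l k (by rwa [add_comm]))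
    rw [Function.iterate_succ_apply,
      partialD_smul hΩ (ha.of_le (by norm_cast; lia)) l (hf.of_le (by lia)),
      iterate_partialD_add l k c₁.contDiff c₂.contDiff]
    calc _ ≤ 2 * sqNorm ((partialD l)^[k] fun x => pdWR Ω l a x • f x) +
          2 * sqNorm ((partialD l)^[k] fun x => a x • partialD l f x) :=
          sqNorm_add_le (n := 0) (IsCompactlyCn.iterate_partialD l k (by rwa [zero_add]))
            (IsCompactlyCn.iterate_partialD l k (by rwa [zero_add]))
      _ ≤ 2 * (K₁ * (8 * R ^ 2 * sqNorm ((partialD l)^[k + 1] f))) +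
          2 * (K₂ * sqNorm ((partialD l)^[k + 1] f)) := by
          gcongr
          · exact (h₁ f hfk).trans (by gcongr)
          · exact h₂ _ (hf.partialD l)
      _ = _ := by ring

lemma sqNorm_sum_le {ι : Type*} (s : Finset ι) {f : ι → E3 → F}
    (hf : ∀ i ∈ s, IsCompactlyCn Ω n (f i)) :
    sqNorm (fun x => ∑ i ∈ s, f i x) ≤ s.card * ∑ i ∈ s, sqNorm (f i) := by
  simp only [sqNorm]
  rw [← integral_finsetSum _ fun i hi => (hf i hi).integrable_sq, ← integral_const_mul]
  refine integral_mono (IsCompactlyCn.sum s hf).integrable_sq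
    ((integrable_finsetSum _ fun i hi => (hf i hi).integrable_sq).const_mul _) fun x => ?_
  exact (pow_le_pow_left₀ (norm_nonneg _) (norm_sum_le s fun i => f i x) 2).trans
    sq_sum_le_card_mul_sum_sq

end CompactlySupported

section Operator

open Set

variable {Ω : Set E3}

lemma pdW_iterate_eqOn (hΩ : IsOpen Ω) (l : Fin 3) (k : ℕ) {f g : E3 → CH} (h : EqOn f g Ω) :
    EqOn ((pdW Ω l)^[k] f) ((partialD l)^[k] g) Ω := by
  induction k with
  | zero => exact h
  | succ k ih =>
    intro x hx
    simp only [Function.iterate_succ_apply', pdW, partialD]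
    rw [fderivWithin_congr' ih hx, fderivWithin_of_isOpen hΩ hx]

lemma exists_abs_pdWR_iterate_le {m : ℕ} {a : Fin 3 → E3 → ℝ} (ha : GoodCoeff Ω m a) (l : Fin 3)
    {j : ℕ} (hj : j ≤ m) : ∃ B : ℝ, ∀ x ∈ Ω, |(pdWR Ω l)^[j] (a l) x| ≤ B := by
  obtain ⟨B, hB⟩ := (ha l).2 (Pi.single l j) (by
    simp only [multiIdxLe, Finset.mem_filter, Fintype.mem_piFinset, Finset.mem_range]
    fin_cases l <;> simp [Fin.forall_fin_succ, Pi.single_apply] <;> lia)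
  refine ⟨B, fun x hx => ?_⟩
  have := hB x hx
  fin_cases l <;> simpa [pdMultiR] using this

/-- The quaternionic inner product as a bounded real-bilinear map. -/
def qipL : CH →L[ℝ] CH →L[ℝ] HQ :=
  (LinearMap.mk₂ ℝ qip
    (fun u u' v => by simp only [qip, Prod.fst_add, Prod.snd_add, star_add, add_mul]; abel)
    (fun c u v => by simp [qip])
    (fun u v v' => by simp only [qip, Prod.fst_add, Prod.snd_add, mul_add]; abel)
    (fun c u v => by simp [qip])).mkContinuous₂ 2 fun u v => by
      have h : ‖qip u v‖ ≤ ‖u.1‖ * ‖v.1‖ + ‖u.2‖ * ‖v.2‖ := by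
        refine (norm_add_le _ _).trans ?_
        simp [norm_mul]
      have h₁ := mul_le_mul (norm_fst_le u) (norm_fst_le v) (norm_nonneg _) (norm_nonneg u)
      have h₂ := mul_le_mul (norm_snd_le u) (norm_snd_le v) (norm_nonneg _) (norm_nonneg u)
      simp only [LinearMap.mk₂_apply]
      linarith

lemma qipL_apply (u v : CH) : qipL u v = qip u v := rfl

/-- The real-linear map `w ↦ i^k (p w)`. -/
def symbolL (k : ℕ) (p : HQ) : CH →L[ℝ] CH :=
  LinearMap.toContinuousLinearMap
    (((LinearMap.prod (-LinearMap.snd ℝ HQ HQ) (LinearMap.fst ℝ HQ HQ)) ^ k) ∘ₗ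
      LinearMap.prodMap (LinearMap.mulLeft ℝ p) (LinearMap.mulLeft ℝ p))

lemma symbolL_apply (k : ℕ) (p : HQ) (w : CH) : symbolL k p w = Ci^[k] (lmul p w) := by
  simp only [symbolL, LinearMap.coe_toContinuousLinearMap', LinearMap.comp_apply,
    Module.End.pow_apply]
  rfl

lemma Ci_iterate_sum_smul (k : ℕ) (c : Fin 3 → ℝ) (w : Fin 3 → CH) :
    Ci^[k] (∑ l, c l • lmul (qe l) (w l)) = ∑ l, c l • symbolL k (qe l) (w l) := by
  have h : ∀ z : CH, Ci^[k] z = symbolL k 1 z := fun z => by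
    rw [symbolL_apply]; simp [lmul]
  rw [h, map_sum]
  refine Finset.sum_congr rfl fun l _ => ?_
  rw [map_smul, ← h, symbolL_apply]

/-- The operator `T` on functions defined on the whole space. -/
def globalT (m : ℕ) (a : Fin 3 → E3 → ℝ) (u : E3 → CH) : E3 → CH :=
  fun x => ∑ l : Fin 3, a l x • symbolL (m - 1) (qe l) ((partialD l)^[m] u x)

/-- The sum of the squared `L²` norms of the pure `m`-th partial derivatives. -/
def globalDmNsq (m : ℕ) (u : E3 → CH) : ℝ :=
  ∑ l : Fin 3, sqNorm ((partialD l)^[m] u)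

lemma sqNorm_le_globalDmNsq (m : ℕ) (u : E3 → CH) (l : Fin 3) :
    sqNorm ((partialD l)^[m] u) ≤ globalDmNsq m u :=
  Finset.single_le_sum (f := fun l => sqNorm ((partialD l)^[m] u))
    (fun _ _ => sqNorm_nonneg _) (Finset.mem_univ l)

variable {m n : ℕ} {a : Fin 3 → E3 → ℝ}

lemma Tq_eqOn_globalT (hΩ : IsOpen Ω) {f g : E3 → CH} (h : EqOn f g Ω) :
    EqOn (Tq Ω m a f) (globalT m a g) Ω := by
  intro x hx
  simp only [Tq, globalT, ← Ci_iterate_sum_smul]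
  congr 1
  exact Finset.sum_congr rfl fun l _ => by rw [pdW_iterate_eqOn hΩ l m h hx]

lemma isCompactlyCn_globalT_term (hΩ : IsOpen Ω) (ha : GoodCoeff Ω m a) (hn : n ≤ m)
    {u : E3 → CH} (hu : IsCompactlyCn Ω (n + m) u) (l : Fin 3) :
    IsCompactlyCn Ω n
      (fun x => a l x • symbolL (m - 1) (qe l) ((partialD l)^[m] u x)) :=
  ((IsCompactlyCn.iterate_partialD l m hu).clm_comp (symbolL (m - 1) (qe l))).smul hΩ
    ((ha l).1.of_le (by exact_mod_cast hn))

lemma isCompactlyCn_globalT (hΩ : IsOpen Ω) (ha : GoodCoeff Ω m a) (hn : n ≤ m)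
    {u : E3 → CH} (hu : IsCompactlyCn Ω (n + m) u) : IsCompactlyCn Ω n (globalT m a u) :=
  IsCompactlyCn.sum _ fun l _ => isCompactlyCn_globalT_term hΩ ha hn hu l

lemma exists_sqNorm_globalT_le (hΩ : IsOpen Ω) (ha : GoodCoeff Ω m a) :
    ∃ K : ℝ, 0 ≤ K ∧ ∀ u : E3 → CH, IsCompactlyCn Ω m u →
      sqNorm (globalT m a u) ≤ K * globalDmNsq m u := by
  choose B hB using fun l => exists_abs_pdWR_iterate_le ha l (Nat.zero_le m)
  refine ⟨3 * ∑ l, (B l * ‖symbolL (m - 1) (qe l)‖) ^ 2, by positivity, fun u hu => ?_⟩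
  have hu₀ : IsCompactlyCn Ω (0 + m) u := by rwa [zero_add]
  refine (sqNorm_sum_le Finset.univ fun l _ =>
    isCompactlyCn_globalT_term hΩ ha m.zero_le hu₀ l).trans ?_
  simp only [Finset.card_univ, Fintype.card_fin, Nat.cast_ofNat]
  rw [mul_assoc, Finset.sum_mul]
  refine mul_le_mul_of_nonneg_left (Finset.sum_le_sum fun l _ => ?_) (by norm_num)
  refine (sqNorm_le_of_norm_le (IsCompactlyCn.iterate_partialD l m hu₀)
    (isCompactlyCn_globalT_term hΩ ha m.zero_le hu₀ l) fun x hx => ?_).trans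
    (mul_le_mul_of_nonneg_left (sqNorm_le_globalDmNsq m u l) (sq_nonneg _))
  rw [norm_smul, Real.norm_eq_abs, mul_assoc]
  exact mul_le_mul (hB l x hx) (ContinuousLinearMap.le_opNorm _ _) (norm_nonneg _)
    ((abs_nonneg _).trans (hB l x hx))

/-- Moving all `m` derivatives of `T` to the second argument. -/
lemma exists_norm_integral_qip_globalT_le (hΩ : IsOpen Ω) {R : ℝ} (hR : ∀ x ∈ Ω, ‖x‖ ≤ R)
    (ha : GoodCoeff Ω m a) :
    ∃ K : ℝ, 0 ≤ K ∧ ∀ w v : E3 → CH, IsCompactlyCn Ω m w → IsCompactlyCn Ω m v →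
      ‖∫ x, qipL (globalT m a w x) (v x)‖ ≤ K * √(sqNorm w) * √(globalDmNsq m v) := by
  choose K hK₀ hK using fun l => exists_sqNorm_iterate_partialD_smul_le hΩ hR l m (ha l).1
    fun j hj => exists_abs_pdWR_iterate_le ha l hj
  choose c hc₀ hc using fun l =>
    exists_norm_integral_clm₂_le Ω (qipL.comp (symbolL (m - 1) (qe l)))
  refine ⟨∑ l, c l * √(K l), Finset.sum_nonneg fun l _ => mul_nonneg (hc₀ l) (Real.sqrt_nonneg _),
    fun w v hw hv => ?_⟩
  have hw₀ : IsCompactlyCn Ω (0 + m) w := by rwa [zero_add]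
  have hav : ∀ l, IsCompactlyCn Ω m (fun x => a l x • v x) := fun l => hv.smul hΩ (ha l).1
  have hexp : ∀ x, qipL (globalT m a w x) (v x) =
      ∑ l, qipL.comp (symbolL (m - 1) (qe l)) ((partialD l)^[m] w x) (a l x • v x) := fun x => by
    simp [globalT]
  simp only [hexp]
  rw [integral_finsetSum _ fun l _ =>
    (IsCompactlyCn.iterate_partialD l m hw₀).integrable_clm₂ _ (hav l).continuous]
  simp only [Finset.sum_mul]
  refine (norm_sum_le _ _).trans (Finset.sum_le_sum fun l _ => ?_)
  rw [integral_clm₂_iterate_partialD _ l m hw (hav l), norm_smul]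
  have hDav : IsCompactlyCn Ω 0 ((partialD l)^[m] fun x => a l x • v x) :=
    IsCompactlyCn.iterate_partialD l m (by rw [zero_add]; exact hav l)
  have hle : √(sqNorm ((partialD l)^[m] fun x => a l x • v x)) ≤ √(K l) * √(globalDmNsq m v) := by
    rw [← Real.sqrt_mul (hK₀ l)]
    exact Real.sqrt_le_sqrt ((hK l v hv).trans
      (mul_le_mul_of_nonneg_left (sqNorm_le_globalDmNsq m v l) (hK₀ l)))
  calc _ ≤ c l * (√(sqNorm w) * √(sqNorm ((partialD l)^[m] fun x => a l x • v x))) := by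
        simpa using hc l m 0 _ _ hw hDav
    _ ≤ c l * (√(sqNorm w) * (√(K l) * √(globalDmNsq m v))) :=
        mul_le_mul_of_nonneg_left (mul_le_mul_of_nonneg_left hle (Real.sqrt_nonneg _)) (hc₀ l)
    _ = _ := by ring

lemma IsTestFun.isCompactlyCn {u : E3 → CH} (hu : IsTestFun Ω u) (n : ℕ) :
    IsCompactlyCn Ω n u :=
  ⟨hu.1.of_le (by exact_mod_cast le_top), hu.2.1, hu.2.2⟩

lemma globalDmNsq_le_DmNsq (hΩ : IsOpen Ω) {u : E3 → CH} (hu : IsCompactlyCn Ω m u) :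
    globalDmNsq m u ≤ DmNsq Ω m u := by
  refine Finset.sum_le_sum fun l _ => ?_
  have hD : IsCompactlyCn Ω 0 ((partialD l)^[m] u) :=
    IsCompactlyCn.iterate_partialD l m (by rwa [zero_add])
  have h₁ := hD.clm_comp (ContinuousLinearMap.fst ℝ HQ HQ)
  have h₂ := hD.clm_comp (ContinuousLinearMap.snd ℝ HQ HQ)
  have heq : L2nsq Ω ((pdW Ω l)^[m] u) = ∫ x, qmodSq ((partialD l)^[m] u x) := by
    rw [L2nsq, setIntegral_congr_fun hΩ.measurableSet fun x hx =>
      congrArg qmodSq (pdW_iterate_eqOn hΩ l m (eqOn_refl u Ω) hx)]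
    exact setIntegral_eq_integral_of_forall_compl_eq_zero fun x hx => by
      simp [qmodSq, hD.eq_zero hx]
  rw [heq]
  refine integral_mono hD.integrable_sq (h₁.integrable_sq.add h₂.integrable_sq) fun x => ?_
  simp only [qmodSq, Prod.norm_def]
  rcases max_cases ‖((partialD l)^[m] u x).1‖ ‖((partialD l)^[m] u x).2‖ with h | h <;>
    rw [h.1] <;>
    nlinarith [sq_nonneg ‖((partialD l)^[m] u x).1‖, sq_nonneg ‖((partialD l)^[m] u x).2‖]

lemma qL2ip_Qq_eq (hΩ : IsOpen Ω) (ha : GoodCoeff Ω m a) (s : HQ) {u v : E3 → CH}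
    (hu : IsCompactlyCn Ω (m + m) u) (hv : IsCompactlyCn Ω m v) :
    qL2ip Ω (Qq Ω m a s u) v =
      (∫ x, qipL (globalT m a (globalT m a u) x) (v x)) -
        (2 * s.re) • (∫ x, qipL (globalT m a u x) (v x)) + ‖s‖ ^ 2 • ∫ x, qipL (u x) (v x) := by
  have hT : IsCompactlyCn Ω m (globalT m a u) := isCompactlyCn_globalT hΩ ha le_rfl hu
  have hTT : IsCompactlyCn Ω 0 (globalT m a (globalT m a u)) :=
    isCompactlyCn_globalT hΩ ha m.zero_le (by rwa [zero_add])
  have hTu : EqOn (Tq Ω m a u) (globalT m a u) Ω := Tq_eqOn_globalT hΩ (eqOn_refl u Ω)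
  have hcongr : EqOn (fun x => qip (Qq Ω m a s u x) (v x))
      (fun x => qipL (globalT m a (globalT m a u) x) (v x) -
        (2 * s.re) • qipL (globalT m a u x) (v x) + ‖s‖ ^ 2 • qipL (u x) (v x)) Ω := by
    intro x hx
    simp only [Qq, ← qipL_apply, hTu hx, Tq_eqOn_globalT hΩ hTu hx, map_add, map_sub, map_smul,
      add_apply, sub_apply, smul_apply]
  have i₁ := hTT.integrable_clm₂ qipL hv.continuous
  have i₂ := (hT.integrable_clm₂ qipL hv.continuous).fun_smul (2 * s.re)
  have i₃ := (hu.integrable_clm₂ qipL hv.continuous).fun_smul (‖s‖ ^ 2)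
  rw [qL2ip, setIntegral_congr_fun hΩ.measurableSet hcongr,
    setIntegral_eq_integral_of_forall_compl_eq_zero fun x hx => by simp [hv.eq_zero hx],
    ← integral_smul, ← integral_smul, ← integral_sub i₁ i₂]
  exact integral_add (i₁.sub i₂) i₃

end Operator

/-- continuity of the bilinear form, bounded case. -/
theorem continuity_bounded
    (m : ℕ) (hm : 1 ≤ m)
    (Ω : Set E3) (hΩo : IsOpen Ω) (hΩb : Bornology.IsBounded Ω)
    (CΩ : ℝ) (hCΩ : 0 < CΩ) (hPoin : IsPoincareConst Ω CΩ)
    (a : Fin 3 → E3 → ℝ) (ha : GoodCoeff Ω m a) :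
    ∀ s : HQ, ∃ C : ℝ, 0 < C ∧
      ∀ u v : E3 → CH, IsTestFun Ω u → IsTestFun Ω v →
        ‖qL2ip Ω (Qq Ω m a s u) v‖ ≤
          C * Real.sqrt (DmNsq Ω m u) * Real.sqrt (DmNsq Ω m v) := by
  intro s
  obtain ⟨R, hR⟩ := hΩb.exists_norm_le
  obtain ⟨K₁, hK₁, hT⟩ := exists_sqNorm_globalT_le hΩo ha
  obtain ⟨K₂, hK₂, hTT⟩ := exists_norm_integral_qip_globalT_le hΩo hR ha
  obtain ⟨c, hc, hcs⟩ := exists_norm_integral_clm₂_le Ω qipL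
  have hP : ∀ w : E3 → CH, IsCompactlyCn Ω m w →
      √(sqNorm w) ≤ √((8 * R ^ 2) ^ m) * √(globalDmNsq m w) := fun w hw => by
    rw [← Real.sqrt_mul (by positivity)]
    exact Real.sqrt_le_sqrt ((sqNorm_le_iterate_partialD hR 0 m hw).trans
      (mul_le_mul_of_nonneg_left (sqNorm_le_globalDmNsq m w 0) (by positivity)))
  set P : ℝ := √((8 * R ^ 2) ^ m)
  have hP₀ : 0 ≤ P := Real.sqrt_nonneg _
  set C : ℝ := K₂ * √K₁ + |2 * s.re| * (c * (√K₁ * P)) + ‖s‖ ^ 2 * (c * (P * P)) with hC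
  have hC₀ : 0 ≤ C := by positivity
  refine ⟨C + 1, by positivity, fun u v hu hv => ?_⟩
  have hum := hu.isCompactlyCn m
  have hvm := hv.isCompactlyCn m
  have hTu : IsCompactlyCn Ω m (globalT m a u) :=
    isCompactlyCn_globalT hΩo ha le_rfl (hu.isCompactlyCn _)
  set du := √(globalDmNsq m u)
  set dv := √(globalDmNsq m v)
  have hTu' : √(sqNorm (globalT m a u)) ≤ √K₁ * du := by
    rw [← Real.sqrt_mul hK₁]
    exact Real.sqrt_le_sqrt (hT u hum)
  have hmain : ‖qL2ip Ω (Qq Ω m a s u) v‖ ≤ C * du * dv := by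
    rw [qL2ip_Qq_eq hΩo ha s (hu.isCompactlyCn _) hvm]
    refine (norm_add_le _ _).trans ((add_le_add_left (norm_sub_le _ _) _).trans ?_)
    rw [norm_smul, norm_smul, Real.norm_eq_abs, norm_pow, norm_norm]
    calc _ ≤ K₂ * (√K₁ * du) * dv + |2 * s.re| * (c * ((√K₁ * du) * (P * dv))) +
          ‖s‖ ^ 2 * (c * ((P * du) * (P * dv))) := by
          gcongr
          · exact (hTT _ v hTu hvm).trans (by gcongr)
          · refine (hcs m m _ _ hTu hvm).trans ?_
            gcongr
            exact hP v hvm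
          · refine (hcs m m _ _ hum hvm).trans ?_
            gcongr
            · exact hP u hum
            · exact hP v hvm
      _ = C * du * dv := by rw [hC]; ring
  refine hmain.trans ?_
  gcongr
  · exact le_add_of_nonneg_right zero_le_one
  · exact Real.sqrt_le_sqrt (globalDmNsq_le_DmNsq hΩo hum)
  · exact Real.sqrt_le_sqrt (globalDmNsq_le_DmNsq hΩo hvm)
end
end

section
/- (Weighted Poincaré inequality on domains with property (R).) Let Ω ⊆ ℝ³ be an open set having property (R) with respect to a point P ∈ ℝ³ \ closure(Ω). Let φ ∈ C¹(Ω, ℝ) be bounded and positive, and suppose there exists λ > 0 such that for every unit vector ω ∈ ℝ³ and every r > 0 with P + rω ∈ Ω one has (d/dr)[r² φ(P + rω)] ≤ −λ r² φ(P + rω). Then for every real p with 1 ≤ p < ∞ and every u ∈ C_c^∞(Ω, ℝ): ∫_Ω |u(x)|^p φ(x) dx ≤ (p/λ)^p ∫_Ω |∇u(x)|^p φ(x) dx. -/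
noncomputable section

open MeasureTheory Finset

/-- A directional derivative of a compactly supported `C¹` function has integral zero. -/
lemma integral_fderiv_apply_eq_zero {g : E3 → ℝ} (hg : ContDiff ℝ 1 g)
    (hc : HasCompactSupport g) (v : E3) : ∫ x, fderiv ℝ g x v = 0 := by
  have hd : Integrable (fun x => fderiv ℝ g x v) :=
    ((hg.continuous_fderiv one_ne_zero).clm_apply continuous_const).integrable_of_hasCompactSupport
      (hc.fderiv_apply ℝ v)
  have hi : Integrable g := hg.continuous.integrable_of_hasCompactSupport hc
  have h := integral_mul_fderiv_eq_neg_fderiv_mul_of_integrable (μ := (volume : Measure E3))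
    (f := fun _ : E3 => (1 : ℝ)) (g := g) (v := v) (by simp) (by simpa using hd)
    (by simpa using hi) (fun x _ => differentiableAt_const _)
    (fun x _ => hg.differentiable one_ne_zero x)
  simpa using h

/-- A function of class `Cⁿ` around each point of its topological support is of class `Cⁿ`. -/
lemma contDiff_of_contDiffAt_tsupport {f : E3 → ℝ} {n : WithTop ℕ∞}
    (h : ∀ x ∈ tsupport f, ContDiffAt ℝ n f x) : ContDiff ℝ n f := by
  rw [contDiff_iff_contDiffAt]
  intro x
  by_cases hx : x ∈ tsupport f
  · exact h x hx
  · exact contDiffAt_const.congr_of_eventuallyEq (notMem_tsupport_iff_eventuallyEq.mp hx)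

lemma hasFDerivAt_norm_sub_inv {x P : E3} (hx : x ≠ P) :
    HasFDerivAt (fun y => ‖y - P‖⁻¹) (-(‖x - P‖ ^ 3)⁻¹ • innerSL ℝ (x - P)) x := by
  have hpos : 0 < ‖x - P‖ := norm_pos_iff.mpr (sub_ne_zero.mpr hx)
  have h1 : HasFDerivAt (fun y => ‖y - P‖ ^ 2) (2 • innerSL ℝ (x - P)) x := by
    simpa using! ((hasFDerivAt_id x).sub_const P).norm_sq
  have h2 := h1.sqrt (by positivity)
  simp only [Real.sqrt_sq (norm_nonneg _)] at h2
  have h3 := (hasDerivAt_inv hpos.ne').comp_hasFDerivAt x h2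
  refine h3.congr_fderiv ?_
  ext v
  simp
  field_simp

/-- The divergence theorem for the radial field `g(x) (x - P) / ‖x - P‖`. -/
lemma integral_radial_divergence_eq_zero {g : E3 → ℝ} (hg : ContDiff ℝ 1 g)
    (hc : HasCompactSupport g) {P : E3} (hP : P ∉ tsupport g) :
    Integrable (fun x => fderiv ℝ g x (‖x - P‖⁻¹ • (x - P)) + 2 * ‖x - P‖⁻¹ * g x) ∧
      ∫ x, (fderiv ℝ g x (‖x - P‖⁻¹ • (x - P)) + 2 * ‖x - P‖⁻¹ * g x) = 0 := by
  let V : Fin 3 → E3 → ℝ := fun i x => g x * (‖x - P‖⁻¹ * (x i - P i))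
  have hVt : ∀ i, tsupport (V i) ⊆ tsupport g := fun i => tsupport_mul_subset_left
  have hVc : ∀ i, HasCompactSupport (V i) := fun i => hc.mul_right
  have hVd : ∀ i, ContDiff ℝ 1 (V i) := by
    intro i
    refine contDiff_of_contDiffAt_tsupport fun x hx => ?_
    have hxP : x ≠ P := fun h => hP (h ▸ hVt i hx)
    have hne : x - P ≠ 0 := sub_ne_zero.mpr hxP
    refine hg.contDiffAt.mul (ContDiffAt.mul ?_ ?_)
    · exact ((contDiffAt_id.sub contDiffAt_const).norm ℝ hne).inv (norm_ne_zero_iff.mpr hne)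
    · exact ((EuclideanSpace.proj (𝕜 := ℝ) i).contDiff.contDiffAt).sub contDiffAt_const
  have hsum : ∀ x, ∑ i, fderiv ℝ (V i) x (EuclideanSpace.single i 1) =
      fderiv ℝ g x (‖x - P‖⁻¹ • (x - P)) + 2 * ‖x - P‖⁻¹ * g x := by
    intro x
    by_cases hx : x ∈ tsupport g
    swap
    · simp [fderiv_of_notMem_tsupport ℝ hx, image_eq_zero_of_notMem_tsupport hx,
        fun i => fderiv_of_notMem_tsupport ℝ (fun h => hx (hVt i h))]
    have hxP : x ≠ P := fun h => hP (h ▸ hx)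
    have hpos : 0 < ‖x - P‖ := norm_pos_iff.mpr (sub_ne_zero.mpr hxP)
    have hV : ∀ i, fderiv ℝ (V i) x (EuclideanSpace.single i 1) =
        (‖x - P‖⁻¹ * (x i - P i)) * fderiv ℝ g x (EuclideanSpace.single i 1) +
          g x * (‖x - P‖⁻¹ - (‖x - P‖ ^ 3)⁻¹ * (x i - P i) ^ 2) := by
      intro i
      have hcoord : HasFDerivAt (fun y : E3 => y i - P i) (EuclideanSpace.proj (𝕜 := ℝ) i) x :=
        (EuclideanSpace.proj (𝕜 := ℝ) i).hasFDerivAt.sub_const _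
      have h := ((hg.differentiable one_ne_zero x).hasFDerivAt.mul
        ((hasFDerivAt_norm_sub_inv hxP).mul hcoord)).fderiv
      have h' : fderiv ℝ (V i) x = _ := h
      rw [h']
      simp [EuclideanSpace.inner_single_right]
      ring
    have hlin : fderiv ℝ g x (‖x - P‖⁻¹ • (x - P)) =
        ∑ i, (‖x - P‖⁻¹ * (x i - P i)) * fderiv ℝ g x (EuclideanSpace.single i 1) := by
      have hx' : ‖x - P‖⁻¹ • (x - P) =
          ∑ i, (‖x - P‖⁻¹ * (x i - P i)) • (EuclideanSpace.single i 1 : E3) := by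
        ext j
        fin_cases j <;> simp [Fin.sum_univ_three]
      rw [hx', map_sum]
      simp
    have hn : ‖x - P‖ ^ 2 = ∑ i, (x i - P i) ^ 2 := by
      simpa using EuclideanSpace.real_norm_sq_eq (x - P)
    simp only [hV, Finset.sum_add_distrib, hlin]
    rw [← Finset.mul_sum, Finset.sum_sub_distrib, ← Finset.mul_sum, ← hn]
    simp
    field_simp
    ring
  have hint : ∀ i, Integrable (fun x => fderiv ℝ (V i) x (EuclideanSpace.single i 1)) := fun i =>
    (((hVd i).continuous_fderiv one_ne_zero).clm_apply
      continuous_const).integrable_of_hasCompactSupport ((hVc i).fderiv_apply ℝ _)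
  simp only [← hsum]
  refine ⟨integrable_finsetSum _ fun i _ => hint i, ?_⟩
  rw [integral_finsetSum _ fun i _ => hint i]
  exact Finset.sum_eq_zero fun i _ => integral_fderiv_apply_eq_zero (hVd i) (hVc i) _

/-- The decay condition along rays, written with the gradient of the weight. -/
lemma fderiv_radial_le_of_decay {φ : E3 → ℝ} {P x : E3} {lam : ℝ}
    (hφ : DifferentiableAt ℝ φ x) (hx : x ≠ P)
    (hdecay : ∀ ω : E3, ‖ω‖ = 1 → ∀ r : ℝ, 0 < r → P + r • ω = x →
      deriv (fun t : ℝ => t ^ 2 * φ (P + t • ω)) r ≤ -lam * (r ^ 2 * φ (P + r • ω))) :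
    fderiv ℝ φ x (‖x - P‖⁻¹ • (x - P)) + 2 * ‖x - P‖⁻¹ * φ x ≤ -lam * φ x := by
  have hne : x - P ≠ 0 := sub_ne_zero.mpr hx
  have hpos : 0 < ‖x - P‖ := norm_pos_iff.mpr hne
  have hω : ‖‖x - P‖⁻¹ • (x - P)‖ = 1 := by
    rw [norm_smul, norm_inv, norm_norm, inv_mul_cancel₀ hpos.ne']
  have hray : P + ‖x - P‖ • ‖x - P‖⁻¹ • (x - P) = x := by
    rw [smul_inv_smul₀ hpos.ne', add_sub_cancel]
  have h := hdecay _ hω _ hpos hray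
  generalize ‖x - P‖⁻¹ • (x - P) = ω at *
  have hline : HasDerivAt (fun t : ℝ => P + t • ω) ω ‖x - P‖ := by
    simpa using ((hasDerivAt_id ‖x - P‖).smul_const ω).const_add P
  have hφ' : HasFDerivAt φ (fderiv ℝ φ x) (P + ‖x - P‖ • ω) := by
    rw [hray]; exact hφ.hasFDerivAt
  have hd := ((hasDerivAt_pow 2 ‖x - P‖).mul (hφ'.comp_hasDerivAt _ hline)).deriv
  have hd' : deriv (fun t : ℝ => t ^ 2 * φ (P + t • ω)) ‖x - P‖ = _ := hd
  rw [hd', hray] at h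
  simp only [Function.comp_apply, hray] at h
  generalize fderiv ℝ φ x ω = d at *
  generalize ‖x - P‖ = r at *
  have key : r ^ 2 * (d + 2 * r⁻¹ * φ x) ≤ r ^ 2 * (-lam * φ x) := by
    have : r ^ 2 * (d + 2 * r⁻¹ * φ x) = 2 * r * φ x + r ^ 2 * d := by
      field_simp
      ring
    rw [this]
    norm_num at h
    linarith
  exact le_of_mul_le_mul_left key (by positivity)

/-- Young's inequality in the form needed for the weighted Poincaré inequality. -/
lemma mul_rpow_sub_one_mul_le {a b p lam : ℝ} (ha : 0 ≤ a) (hb : 0 ≤ b) (hp : 1 < p)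
    (hlam : 0 < lam) :
    p * b ^ (p - 1) * a ≤ lam * b ^ p - lam / p * (b ^ p - (p / lam) ^ p * a ^ p) := by
  have hp0 : 0 < p := by linarith
  have hpq := Real.HolderConjugate.conjExponent hp
  have h := Real.young_inequality_of_nonneg (a := p / lam * a) (b := b ^ (p - 1))
    (by positivity) (by positivity) hpq
  rw [Real.mul_rpow (by positivity) ha, ← Real.rpow_mul hb, Real.conjExponent,
    mul_div_cancel₀ _ (by linarith : p - 1 ≠ 0)] at h
  have h2 := mul_le_mul_of_nonneg_left h hlam.le
  have e1 : lam * (p / lam * a * b ^ (p - 1)) = p * b ^ (p - 1) * a := by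
    field_simp
  have hp1 : p - 1 ≠ 0 := by linarith
  rw [e1] at h2
  refine h2.trans (le_of_eq ?_)
  field_simp
  ring

/-- The weighted `L^p` integral of a compactly supported continuous function: integrability for
each exponent and continuity in the exponent. -/
lemma weighted_rpow_integral {Ω : Set E3} (hΩ : IsOpen Ω) {φ : E3 → ℝ} (hφ : ContinuousOn φ Ω)
    {f : E3 → ℝ} (hf : Continuous f) (hc : HasCompactSupport f) (hs : tsupport f ⊆ Ω) :
    (∀ p ∈ Set.Ici (1 : ℝ), Integrable fun x => |f x| ^ p * φ x) ∧
      ContinuousOn (fun p : ℝ => ∫ x in Ω, |f x| ^ p * φ x) (Set.Ici 1) := by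
  have hzero : ∀ p x, p ∈ Set.Ici (1 : ℝ) → x ∉ tsupport f → |f x| ^ p * φ x = 0 := by
    intro p x hp hx
    have hp0 : p ≠ 0 := (zero_lt_one.trans_le hp).ne'
    simp [image_eq_zero_of_notMem_tsupport hx, Real.zero_rpow hp0]
  have hcont : ContinuousOn (Function.uncurry fun (p : ℝ) x => |f x| ^ p * φ x)
      (Set.Ici 1 ×ˢ Set.univ) := by
    rintro ⟨p, x⟩ ⟨hp, -⟩
    by_cases hx : x ∈ tsupport f
    · have hφx : ContinuousAt (fun q : ℝ × E3 => φ q.2) (p, x) :=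
        ContinuousAt.comp (g := φ) (hφ.continuousAt (hΩ.mem_nhds (hs hx))) continuousAt_snd
      have hfx : ContinuousAt (fun q : ℝ × E3 => |f q.2| ^ q.1) (p, x) :=
        ContinuousAt.rpow (hf.comp continuous_snd).abs.continuousAt continuousAt_fst
          (Or.inr (zero_lt_one.trans_le hp))
      exact (hfx.mul hφx).continuousWithinAt
    · have h1 : ∀ᶠ q : ℝ × E3 in nhdsWithin (p, x) (Set.Ici 1 ×ˢ Set.univ),
          q.2 ∈ (tsupport f)ᶜ :=
        mem_nhdsWithin_of_mem_nhds
          (((isClosed_tsupport f).isOpen_compl.preimage continuous_snd).mem_nhds hx)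
      refine (continuousWithinAt_const (b := (0 : ℝ))).congr_of_eventuallyEq ?_ (hzero p x hp hx)
      filter_upwards [h1, self_mem_nhdsWithin] with q hq hqs
      exact hzero q.1 q.2 hqs.1 hq
  constructor
  · intro p hp
    have hcp : Continuous fun x => |f x| ^ p * φ x := by
      rw [← continuousOn_univ]
      exact hcont.comp (f := fun x : E3 => (p, x)) (by fun_prop) fun x _ => ⟨hp, Set.mem_univ x⟩
    exact hcp.integrable_of_hasCompactSupport (HasCompactSupport.intro hc fun x => hzero p x hp)
  · refine (continuousOn_integral_of_compact_support (μ := volume) hc hcont hzero).congr ?_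
    intro p hp
    exact setIntegral_eq_integral_of_forall_compl_eq_zero fun x hx =>
      hzero p x hp fun h => hx (hs h)

lemma norm_gradient_eq_norm_fderiv (u : E3 → ℝ) (x : E3) :
    ‖gradient u x‖ = ‖fderiv ℝ u x‖ := by
  rw [gradient, LinearIsometryEquiv.norm_map]

/-- The weighted Poincaré inequality for exponents `p > 1`, under the decay condition in
differential form. -/
lemma weighted_poincare_of_one_lt {Ω : Set E3} (hΩ : IsOpen Ω) {P : E3} (hP : P ∉ Ω)
    {φ : E3 → ℝ} (hφC : ContDiffOn ℝ 1 φ Ω) (hφpos : ∀ x ∈ Ω, 0 < φ x) {lam : ℝ} (hlam : 0 < lam)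
    (hdecay : ∀ x ∈ Ω,
      fderiv ℝ φ x (‖x - P‖⁻¹ • (x - P)) + 2 * ‖x - P‖⁻¹ * φ x ≤ -lam * φ x)
    {p : ℝ} (hp : 1 < p) {u : E3 → ℝ} (hu : ContDiff ℝ 1 u) (huc : HasCompactSupport u)
    (hus : tsupport u ⊆ Ω) :
    ∫ x in Ω, |u x| ^ p * φ x ≤ (p / lam) ^ p * ∫ x in Ω, ‖fderiv ℝ u x‖ ^ p * φ x := by
  have hp0 : 0 < p := by linarith
  set g : E3 → ℝ := fun x => |u x| ^ p * φ x with hg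
  have habs : ContDiff ℝ 1 fun x => |u x| ^ p := (contDiff_norm_rpow (E := ℝ) hp).comp hu
  have hgzero : ∀ x ∉ tsupport u, g x = 0 := fun x hx => by
    simp [hg, image_eq_zero_of_notMem_tsupport hx, Real.zero_rpow hp0.ne']
  have hgt : tsupport g ⊆ tsupport u :=
    closure_minimal (fun x hx => by_contra fun h => hx (hgzero x h)) (isClosed_tsupport u)
  have hgC : ContDiff ℝ 1 g := contDiff_of_contDiffAt_tsupport fun x hx =>
    habs.contDiffAt.mul (hφC.contDiffAt (hΩ.mem_nhds (hus (hgt hx))))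
  have hgc : HasCompactSupport g := HasCompactSupport.intro huc hgzero
  obtain ⟨hGi, hG0⟩ := integral_radial_divergence_eq_zero hgC hgc (P := P)
    fun h => hP (hus (hgt h))
  set G : E3 → ℝ := fun x =>
    fderiv ℝ g x (‖x - P‖⁻¹ • (x - P)) + 2 * ‖x - P‖⁻¹ * g x with hG
  have hGΩ : ∫ x in Ω, G x = 0 := by
    rw [setIntegral_eq_integral_of_forall_compl_eq_zero, hG0]
    intro x hx
    have hxg : x ∉ tsupport g := fun h => hx (hus (hgt h))
    simp [hG, fderiv_of_notMem_tsupport ℝ hxg, image_eq_zero_of_notMem_tsupport hxg]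
  have hgi : Integrable g := hgC.continuous.integrable_of_hasCompactSupport hgc
  have hdi : Integrable fun x => ‖fderiv ℝ u x‖ ^ p * φ x := by
    have hnt : tsupport (fun x => ‖fderiv ℝ u x‖) ⊆ tsupport u :=
      (closure_mono fun x hx => by simpa using hx).trans (tsupport_fderiv_subset ℝ)
    simpa using (weighted_rpow_integral hΩ hφC.continuousOn
      (hu.continuous_fderiv one_ne_zero).norm (huc.fderiv ℝ).norm (hnt.trans hus)).1 p hp.le
  have hpt : ∀ x ∈ Ω, g x - (p / lam) ^ p * (‖fderiv ℝ u x‖ ^ p * φ x) ≤ -(p / lam) * G x := by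
    intro x hx
    have hxP : x ≠ P := fun h => hP (h ▸ hx)
    have hφd : DifferentiableAt ℝ φ x :=
      (hφC.contDiffAt (hΩ.mem_nhds hx)).differentiableAt one_ne_zero
    have hab : HasFDerivAt (fun y => |u y| ^ p)
        ((p * |u x| ^ (p - 2) * u x) • fderiv ℝ u x) x :=
      (hasDerivAt_abs_rpow (u x) hp).comp_hasFDerivAt x
        (hu.differentiable one_ne_zero x).hasFDerivAt
    have hgd : fderiv ℝ g x = _ := (hab.mul hφd.hasFDerivAt).fderiv
    have hunit : ‖‖x - P‖⁻¹ • (x - P)‖ = 1 := by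
      rw [norm_smul, norm_inv, norm_norm,
        inv_mul_cancel₀ (norm_ne_zero_iff.mpr (sub_ne_zero.mpr hxP))]
    have hGx : G x = |u x| ^ p * (fderiv ℝ φ x (‖x - P‖⁻¹ • (x - P)) + 2 * ‖x - P‖⁻¹ * φ x) +
        φ x * (p * |u x| ^ (p - 2) * u x * fderiv ℝ u x (‖x - P‖⁻¹ • (x - P))) := by
      simp only [hG]
      rw [hgd]
      simp only [hg, add_apply, smul_apply, smul_eq_mul]
      ring
    have hpow : |u x| ^ (p - 2) * |u x| = |u x| ^ (p - 1) := by
      rcases (abs_nonneg (u x)).eq_or_lt with h | h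
      · rw [← h, mul_zero, Real.zero_rpow (by linarith)]
      · rw [← Real.rpow_add_one h.ne']
        ring_nf
    have hrad : p * |u x| ^ (p - 2) * u x * fderiv ℝ u x (‖x - P‖⁻¹ • (x - P)) ≤
        p * |u x| ^ (p - 1) * ‖fderiv ℝ u x‖ := by
      refine (le_abs_self _).trans ?_
      rw [abs_mul, abs_mul, abs_of_nonneg (by positivity : 0 ≤ p * |u x| ^ (p - 2)),
        mul_assoc p, hpow]
      gcongr
      simpa [hunit] using (fderiv ℝ u x).le_opNorm (‖x - P‖⁻¹ • (x - P))
    have h1 := mul_le_mul_of_nonneg_left (hdecay x hx)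
      (Real.rpow_nonneg (abs_nonneg (u x)) p)
    have h2 := mul_le_mul_of_nonneg_left (hrad.trans (mul_rpow_sub_one_mul_le
      (norm_nonneg (fderiv ℝ u x)) (abs_nonneg (u x)) hp hlam)) (hφpos x hx).le
    have h3 : G x ≤ -(lam / p) * (g x - (p / lam) ^ p * (‖fderiv ℝ u x‖ ^ p * φ x)) := by
      rw [hGx]
      refine (add_le_add h1 h2).trans (le_of_eq ?_)
      simp only [hg]
      ring
    have h4 := mul_le_mul_of_nonneg_left h3 (by positivity : 0 ≤ p / lam)
    have h5 : p / lam * (-(lam / p) * (g x - (p / lam) ^ p * (‖fderiv ℝ u x‖ ^ p * φ x))) =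
        -(g x - (p / lam) ^ p * (‖fderiv ℝ u x‖ ^ p * φ x)) := by
      have : p / lam * (lam / p) = 1 := by field_simp
      linear_combination (-(g x - (p / lam) ^ p * (‖fderiv ℝ u x‖ ^ p * φ x))) * this
    linarith
  have hmono := setIntegral_mono_on (hgi.sub (hdi.const_mul ((p / lam) ^ p))).integrableOn
    (hGi.const_mul (-(p / lam))).integrableOn hΩ.measurableSet hpt
  simp only [Pi.sub_apply] at hmono
  rw [integral_sub hgi.integrableOn (hdi.const_mul _).integrableOn, integral_const_mul,
    integral_const_mul, hGΩ, mul_zero] at hmono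
  linarith

/-- weighted Poincaré inequality on domains with property (R). -/
theorem weighted_poincare_propertyR
    (Ω : Set E3) (hΩo : IsOpen Ω) (P : E3) (hR : HasPropertyR Ω P)
    (φ : E3 → ℝ) (hφC : ContDiffOn ℝ 1 φ Ω)
    (hφb : ∃ B : ℝ, ∀ x ∈ Ω, φ x ≤ B) (hφpos : ∀ x ∈ Ω, 0 < φ x)
    (lam : ℝ) (hlam : 0 < lam)
    (hdecay : ∀ ω : E3, ‖ω‖ = 1 → ∀ r : ℝ, 0 < r → P + r • ω ∈ Ω →
      deriv (fun t : ℝ => t ^ 2 * φ (P + t • ω)) r ≤ -lam * (r ^ 2 * φ (P + r • ω))) :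
    ∀ p : ℝ, 1 ≤ p → ∀ u : E3 → ℝ, IsTestFunR Ω u →
      ∫ x in Ω, |u x| ^ p * φ x ≤
        (p / lam) ^ p * ∫ x in Ω, ‖gradient u x‖ ^ p * φ x := by
  obtain ⟨hPc, -⟩ := hR
  have hP : P ∉ Ω := fun h => hPc (subset_closure h)
  rintro p hp u ⟨hu, huc, hus⟩
  have hu1 : ContDiff ℝ 1 u := hu.of_le (by exact_mod_cast le_top)
  simp only [norm_gradient_eq_norm_fderiv]
  have hlt : ∀ q : ℝ, 1 < q → ∫ x in Ω, |u x| ^ q * φ x ≤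
      (q / lam) ^ q * ∫ x in Ω, ‖fderiv ℝ u x‖ ^ q * φ x := fun q hq =>
    weighted_poincare_of_one_lt hΩo hP hφC hφpos hlam
      (fun x hx => fderiv_radial_le_of_decay
        ((hφC.contDiffAt (hΩo.mem_nhds hx)).differentiableAt one_ne_zero) (fun h => hP (h ▸ hx))
        fun ω hω r hr h => hdecay ω hω r hr (h ▸ hx)) hq hu1 huc hus
  rcases hp.eq_or_lt with rfl | hp1
  swap
  · exact hlt p hp1
  have hnt : tsupport (fun x => ‖fderiv ℝ u x‖) ⊆ tsupport u :=
    (closure_mono fun x hx => by simpa using hx).trans (tsupport_fderiv_subset ℝ)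
  have hA := (weighted_rpow_integral hΩo hφC.continuousOn hu1.continuous huc hus).2
  have hB := (weighted_rpow_integral hΩo hφC.continuousOn
    (hu1.continuous_fderiv one_ne_zero).norm (huc.fderiv ℝ).norm (hnt.trans hus)).2
  simp only [abs_norm] at hB
  have hC : ContinuousAt (fun q : ℝ => (q / lam) ^ q) 1 :=
    (continuousAt_id.div_const lam).rpow continuousAt_id (Or.inr one_pos)
  have hsub : nhdsWithin (1 : ℝ) (Set.Ioi 1) ≤ nhdsWithin 1 (Set.Ici 1) :=
    nhdsWithin_mono _ Set.Ioi_subset_Ici_self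
  refine le_of_tendsto_of_tendsto ((hA 1 Set.self_mem_Ici).mono_left hsub)
    (((hC.continuousWithinAt (s := Set.Ici 1)).mul (hB 1 Set.self_mem_Ici)).mono_left hsub) ?_
  filter_upwards [self_mem_nhdsWithin] with q hq using hlt q hq
end
end

section
/- (Weighted Poincaré inequality, half-space version.) Let c ∈ ℝ, let H := {x ∈ ℝ³ : x₁ > c}, and let Ω ⊆ H be open. Let φ ∈ C¹(H, ℝ) be bounded and positive with ∂_{x₁} φ(x) ≤ −λ φ(x) for all x ∈ H, for some λ > 0. Then for every real p with 1 ≤ p < ∞ and every u ∈ C_c^∞(Ω, ℝ): ∫_Ω |u(x)|^p φ(x) dx ≤ (p/λ)^p ∫_Ω |∇u(x)|^p φ(x) dx. -/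
noncomputable section

open MeasureTheory Finset

section Auxiliary

variable {E : Type*} [NormedAddCommGroup E]

/-- A continuous function on an open set, multiplied by a continuous function with compact support
inside that set, is integrable. -/
theorem integrable_mul_of_continuousOn_of_tsupport_subset [MeasurableSpace E] [BorelSpace E]
    {μ : Measure E} [IsFiniteMeasureOnCompacts μ] {U : Set E} (hU : IsOpen U) {w φ : E → ℝ}
    (hw : Continuous w) (hwc : HasCompactSupport w) (hwU : tsupport w ⊆ U)
    (hφ : ContinuousOn φ U) : Integrable (fun x => w x * φ x) μ := by
  refine Continuous.integrable_of_hasCompactSupport ?_ hwc.mul_right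
  refine continuous_of_tsupport fun x hx => ?_
  have hxU : x ∈ U := hwU (tsupport_mul_subset_left hx)
  exact hw.continuousAt.mul (hφ.continuousAt (hU.mem_nhds hxU))

variable [NormedSpace ℝ E]

theorem integrable_lineDeriv_of_hasCompactSupport [MeasurableSpace E] [BorelSpace E]
    [FiniteDimensional ℝ E] {μ : Measure E} [μ.IsAddHaarMeasure] {C : NNReal} {g : E → ℝ}
    (hg : LipschitzWith C g) (hgc : HasCompactSupport g) (v : E) :
    Integrable (fun x => lineDeriv ℝ g x v) μ := by
  rw [← integrableOn_iff_integrable_of_support_subset (s := tsupport g)]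
  · exact (hg.locallyIntegrable_lineDeriv v).integrableOn_isCompact hgc
  · intro x hx
    by_contra hxg
    have h0 : g =ᶠ[nhds x] fun _ => 0 := notMem_tsupport_iff_eventuallyEq.1 hxg
    refine hx (h0.lineDeriv_eq.trans ?_)
    simp [lineDeriv]

theorem integral_lineDeriv_eq_zero [MeasurableSpace E] [BorelSpace E]
    [FiniteDimensional ℝ E] {μ : Measure E} [μ.IsAddHaarMeasure] {C : NNReal} {g : E → ℝ}
    (hg : LipschitzWith C g) (hgc : HasCompactSupport g) (v : E) :
    ∫ x, lineDeriv ℝ g x v ∂μ = 0 := by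
  have hone : LipschitzWith 0 fun _ : E => (1 : ℝ) := LipschitzWith.const 1
  have h := hone.integral_lineDeriv_mul_eq (μ := μ) hg hgc (-v)
  simpa [lineDeriv] using h.symm

theorem exists_lipschitzWith_abs_rpow {w : E → ℝ} (hw : ContDiff ℝ 1 w)
    (hwc : HasCompactSupport w) {p : ℝ} (hp : 1 ≤ p) :
    ∃ C : NNReal, LipschitzWith C fun x => |w x| ^ p := by
  obtain ⟨C, hC⟩ := hw.lipschitzWith_of_hasCompactSupport hwc one_ne_zero
  obtain ⟨M, hM⟩ := hwc.exists_bound_of_continuous hw.continuous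
  have hpow : ContDiff ℝ 1 fun t : ℝ => t ^ p := by
    exact_mod_cast Real.contDiff_rpow_const_of_le (n := 1) (by exact_mod_cast hp)
  obtain ⟨D, hD⟩ := (hpow.locallyLipschitz.locallyLipschitzOn
    (s := Set.Icc 0 M)).exists_lipschitzOnWith_of_compact isCompact_Icc
  have habs : LipschitzWith (1 * C) fun x => |w x| := by
    simpa [Real.norm_eq_abs, Function.comp_def] using lipschitzWith_one_norm.comp hC
  exact ⟨_, lipschitzOnWith_univ.1 <|
    hD.comp (habs.lipschitzOnWith (s := Set.univ)) fun x _ => ⟨abs_nonneg _, hM x⟩⟩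

/-- Young's inequality in the form `a ^ (p - 1) * b ≤ (1 - 1/p) * a ^ p + b ^ p / p`. -/
theorem rpow_sub_one_mul_le {a b p : ℝ} (ha : 0 ≤ a) (hb : 0 ≤ b) (hp : 1 ≤ p) :
    a ^ (p - 1) * b ≤ (1 - p⁻¹) * a ^ p + p⁻¹ * b ^ p := by
  have hp0 : 0 < p := by linarith
  have h := Real.geom_mean_le_arith_mean2_weighted (w₁ := 1 - p⁻¹) (w₂ := p⁻¹)
    (sub_nonneg.2 (inv_le_one_of_one_le₀ hp)) (by positivity) (Real.rpow_nonneg ha p)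
    (Real.rpow_nonneg hb p) (by ring)
  rwa [← Real.rpow_mul ha, ← Real.rpow_mul hb, mul_inv_cancel₀ hp0.ne', Real.rpow_one,
    mul_sub, mul_one, mul_inv_cancel₀ hp0.ne'] at h

/-- The pointwise estimate behind the weighted Poincaré inequality. -/
theorem lineDeriv_abs_rpow_mul_le {u φ : E → ℝ} {x e : E} (hu : DifferentiableAt ℝ u x)
    (hφ : DifferentiableAt ℝ φ x) (hux : u x ≠ 0) (hφx : 0 ≤ φ x) {p lam G : ℝ} (hp : 1 ≤ p)
    (hlam : 0 < lam) (hdecay : fderiv ℝ φ x e ≤ -lam * φ x) (hG : |fderiv ℝ u x e| ≤ G) :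
    lineDeriv ℝ (fun y => |u y| ^ p * φ y) x e ≤
      lam / p * ((p / lam) ^ p * (G ^ p * φ x) - |u x| ^ p * φ x) := by
  have hp0 : 0 < p := by linarith
  have hG0 : 0 ≤ G := (abs_nonneg _).trans hG
  have hu' : HasDerivAt (fun t : ℝ => u (x + t • e)) (fderiv ℝ u x e) 0 :=
    hu.hasFDerivAt.hasLineDerivAt e
  have hφ' : HasDerivAt (fun t : ℝ => φ (x + t • e)) (fderiv ℝ φ x e) 0 :=
    hφ.hasFDerivAt.hasLineDerivAt e
  have hux0 : u (x + (0 : ℝ) • e) ≠ 0 := by simpa using hux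
  have habs := ((hasDerivAt_abs hux0).comp (0 : ℝ) hu').rpow_const (p := p)
    (Or.inl (by simpa using hux))
  have hder := (habs.mul hφ').deriv
  have hsign : (SignType.sign (u x) : ℝ) * fderiv ℝ u x e ≤ G := by
    refine (le_abs_self _).trans ?_
    rcases hux.lt_or_gt with h | h <;> simpa [h] using hG
  have hyoung := rpow_sub_one_mul_le (abs_nonneg (u x)) (b := p / lam * G) (by positivity) hp
  rw [Real.mul_rpow (by positivity) hG0] at hyoung
  have hle : lineDeriv ℝ (fun y => |u y| ^ p * φ y) x e ≤
      lam * (|u x| ^ (p - 1) * (p / lam * G)) * φ x - lam * (|u x| ^ p * φ x) := by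
    have heq : lineDeriv ℝ (fun y => |u y| ^ p * φ y) x e =
        (SignType.sign (u x) : ℝ) * fderiv ℝ u x e * (p * |u x| ^ (p - 1) * φ x) +
          |u x| ^ p * fderiv ℝ φ x e := by
      refine Eq.trans ?_ (hder.trans ?_)
      · rfl
      · simp; ring
    have h1 := mul_le_mul_of_nonneg_right hsign
      (show 0 ≤ p * |u x| ^ (p - 1) * φ x by positivity)
    have h2 := mul_le_mul_of_nonneg_left hdecay (show 0 ≤ |u x| ^ p by positivity)
    have h3 : lam * (|u x| ^ (p - 1) * (p / lam * G)) * φ x =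
        G * (p * |u x| ^ (p - 1) * φ x) := by field_simp
    rw [heq, h3]
    linarith
  refine hle.trans ?_
  have h4 := mul_le_mul_of_nonneg_right (mul_le_mul_of_nonneg_left hyoung hlam.le) hφx
  refine (sub_le_sub_right h4 _).trans (le_of_eq ?_)
  field_simp
  ring

end Auxiliary

/-- weighted Poincaré inequality, half-space version. -/
theorem weighted_poincare_halfspace
    (c : ℝ) (Ω : Set E3) (hΩo : IsOpen Ω)
    (hΩsub : Ω ⊆ {x : E3 | c < x 0})
    (φ : E3 → ℝ) (hφC : ContDiffOn ℝ 1 φ {x : E3 | c < x 0})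
    (hφb : ∃ B : ℝ, ∀ x ∈ {x : E3 | c < x 0}, φ x ≤ B)
    (hφpos : ∀ x ∈ {x : E3 | c < x 0}, 0 < φ x)
    (lam : ℝ) (hlam : 0 < lam)
    (hdecay : ∀ x ∈ {x : E3 | c < x 0},
      pdWR {x : E3 | c < x 0} 0 φ x ≤ -lam * φ x) :
    ∀ p : ℝ, 1 ≤ p → ∀ u : E3 → ℝ, IsTestFunR Ω u →
      ∫ x in Ω, |u x| ^ p * φ x ≤
        (p / lam) ^ p * ∫ x in Ω, ‖gradient u x‖ ^ p * φ x := by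
  intro p hp u ⟨hu, huc, huΩ⟩
  set H : Set E3 := {x : E3 | c < x 0} with hH
  have hHo : IsOpen H := isOpen_lt continuous_const (by fun_prop)
  have hp0 : 0 < p := by linarith
  have hu1 : ContDiff ℝ 1 u := hu.of_le (by exact_mod_cast le_top)
  have huH : tsupport u ⊆ H := huΩ.trans hΩsub
  have hφd : ∀ x ∈ H, ContDiffAt ℝ 1 φ x := fun x hx => hφC.contDiffAt (hHo.mem_nhds hx)
  have hgradnorm : ∀ x, ‖gradient u x‖ = ‖fderiv ℝ u x‖ := fun x => by simp [gradient]
  have hgrad0 : ∀ x ∉ tsupport u, gradient u x = 0 := fun x hx => by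
    rw [← norm_eq_zero, hgradnorm, norm_eq_zero]
    exact fderiv_of_notMem_tsupport ℝ hx
  have huInt : Integrable fun x => |u x| ^ p * φ x := by
    have hsub : tsupport (fun x => |u x| ^ p) ⊆ tsupport u :=
      closure_mono fun x hx hux => hx (by simp [hux, hp0.ne'])
    exact integrable_mul_of_continuousOn_of_tsupport_subset hHo
      (hu.continuous.abs.rpow_const fun _ => Or.inr hp0.le)
      (huc.mono' (subset_closure.trans hsub)) (hsub.trans huH) hφC.continuousOn
  have hgradInt : Integrable fun x => ‖gradient u x‖ ^ p * φ x := by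
    have hsub : tsupport (fun x => ‖gradient u x‖ ^ p) ⊆ tsupport u := by
      refine closure_minimal (fun x hx => ?_) (isClosed_tsupport u)
      by_contra hxu
      exact hx (by simp [hgrad0 x hxu, hp0.ne'])
    refine integrable_mul_of_continuousOn_of_tsupport_subset hHo ?_
      (huc.mono' (subset_closure.trans hsub)) (hsub.trans huH) hφC.continuousOn
    simp only [hgradnorm]
    exact (hu1.continuous_fderiv one_ne_zero).norm.rpow_const fun _ => Or.inr hp0.le
  have hg : ∃ C : NNReal, LipschitzWith C fun x => |u x| ^ p * φ x := by
    have hw : ContDiff ℝ 1 fun x => u x * φ x ^ p⁻¹ := by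
      refine contMDiff_iff_contDiff.1 (contMDiff_of_tsupport fun x hx => ContDiffAt.contMDiffAt ?_)
      have hxH : x ∈ H := huH (tsupport_mul_subset_left hx)
      exact hu1.contDiffAt.mul ((hφd x hxH).rpow_const_of_ne (hφpos x hxH).ne')
    obtain ⟨C, hC⟩ := exists_lipschitzWith_abs_rpow hw huc.mul_right hp
    suffices heq : (fun x => |u x| ^ p * φ x) = fun x => |u x * φ x ^ p⁻¹| ^ p from
      ⟨C, heq ▸ hC⟩
    funext x
    by_cases hx : x ∈ H
    · have := hφpos x hx
      rw [abs_mul, abs_of_nonneg (Real.rpow_nonneg this.le _),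
        Real.mul_rpow (abs_nonneg _) (Real.rpow_nonneg this.le _), ← Real.rpow_mul this.le,
        inv_mul_cancel₀ hp0.ne', Real.rpow_one]
    · have : u x = 0 := image_eq_zero_of_notMem_tsupport fun h => hx (huH h)
      simp [this, hp0.ne']
  obtain ⟨C, hC⟩ := hg
  have hgc : HasCompactSupport fun x => |u x| ^ p * φ x :=
    huc.mono fun x hx hux => hx (by simp [hux, hp0.ne'])
  set e : E3 := EuclideanSpace.single 0 1 with he
  have hpoint : ∀ x, lineDeriv ℝ (fun y => |u y| ^ p * φ y) x e ≤
      lam / p * ((p / lam) ^ p * (‖gradient u x‖ ^ p * φ x) - |u x| ^ p * φ x) := by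
    intro x
    by_cases hux : u x = 0
    · have hmin : IsLocalMin (fun t : ℝ => |u (x + t • e)| ^ p * φ (x + t • e)) 0 := by
        refine Filter.Eventually.of_forall fun t => ?_
        simp only [zero_smul, add_zero, hux, abs_zero, Real.zero_rpow hp0.ne', zero_mul]
        by_cases ht : x + t • e ∈ H
        · have := hφpos _ ht
          positivity
        · have : u (x + t • e) = 0 := image_eq_zero_of_notMem_tsupport fun h => ht (huH h)
          simp [this, hp0.ne']
      have hzero : lineDeriv ℝ (fun y => |u y| ^ p * φ y) x e = 0 := hmin.deriv_eq_zero
      rw [hzero, hux, abs_zero, Real.zero_rpow hp0.ne', zero_mul, sub_zero]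
      by_cases hx : x ∈ H
      · have := hφpos _ hx
        positivity
      · simp [hgrad0 x fun h => hx (huH h), hp0.ne']
    · have hx : x ∈ H := huH (subset_tsupport u hux)
      refine lineDeriv_abs_rpow_mul_le (hu1.differentiable one_ne_zero x)
        ((hφd x hx).differentiableAt one_ne_zero) hux (hφpos x hx).le hp hlam ?_ ?_
      · have := hdecay x hx
        rwa [pdWR, fderivWithin_of_isOpen hHo hx] at this
      · rw [hgradnorm]
        simpa [he] using (fderiv ℝ u x).le_opNorm e
  have hmono := integral_mono (integrable_lineDeriv_of_hasCompactSupport hC hgc e)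
    (((hgradInt.const_mul _).sub huInt).const_mul _) hpoint
  rw [integral_lineDeriv_eq_zero hC hgc, integral_const_mul] at hmono
  rw [setIntegral_eq_integral_of_forall_compl_eq_zero fun x hx => by
      simp [image_eq_zero_of_notMem_tsupport fun h => hx (huΩ h), hp0.ne'],
    setIntegral_eq_integral_of_forall_compl_eq_zero fun x hx => by
      simp [hgrad0 x fun h => hx (huΩ h), hp0.ne']]
  have hsub := nonneg_of_mul_nonneg_right hmono (by positivity)
  rw [integral_sub' (hgradInt.const_mul _) huInt, integral_const_mul] at hsub
  linarith
end
end

section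
/- (Mixed derivatives controlled by pure derivatives in L².) For every integer m ≥ 1 there exists a constant K > 0, depending only on m, such that for every u ∈ C_c^∞(ℝ³, ℝ): Σ_{b ∈ ℕ³, |b| = m} ‖∂^b u‖²_{L²(ℝ³)} ≤ K Σ_{l=1}^{3} ‖∂_{x_l}^m u‖²_{L²(ℝ³)}. -/
noncomputable section

open MeasureTheory Finset

section FourierControl

open scoped SchwartzMap FourierTransform LineDeriv ContDiff

/-- A Schwartz function represents the smooth real function `u` when it is its complexification. -/
def Represents (g : 𝓢(E3, ℂ)) (u : E3 → ℝ) : Prop :=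
  ContDiff ℝ ∞ u ∧ ∀ x, g x = (u x : ℂ)

lemma Represents.lineDeriv {g : 𝓢(E3, ℂ)} {u : E3 → ℝ} (h : Represents g u) (l : Fin 3) :
    Represents (∂_{(EuclideanSpace.single l 1 : E3)} g) (pdWR Set.univ l u) := by
  obtain ⟨hu, hg⟩ := h
  refine ⟨?_, fun x => ?_⟩
  · unfold pdWR
    simp only [fderivWithin_univ]
    exact (hu.fderiv_right (m := ∞) le_rfl).clm_apply contDiff_const
  · have hd : HasFDerivAt u (fderiv ℝ u x) x :=
      (hu.differentiable (by simp) x).hasFDerivAt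
    have hgd : HasFDerivAt g (Complex.ofRealCLM.comp (fderiv ℝ u x)) x := by
      rw [show (g : E3 → ℂ) = fun y => Complex.ofRealCLM (u y) from funext hg]
      exact Complex.ofRealCLM.hasFDerivAt.comp x hd
    rw [SchwartzMap.lineDerivOp_apply_eq_fderiv, hgd.fderiv]
    simp [pdWR]

lemma Represents.iterate_lineDeriv {g : 𝓢(E3, ℂ)} {u : E3 → ℝ} (h : Represents g u)
    (l : Fin 3) (n : ℕ) :
    Represents ((fun f : 𝓢(E3, ℂ) => ∂_{(EuclideanSpace.single l 1 : E3)} f)^[n] g)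
      ((pdWR Set.univ l)^[n] u) := by
  induction n with
  | zero => exact h
  | succ n ih =>
    simp only [Function.iterate_succ_apply']
    exact ih.lineDeriv l

lemma Represents.integral_sq_eq {g : 𝓢(E3, ℂ)} {u : E3 → ℝ} (h : Represents g u) :
    ∫ x, u x ^ 2 = ∫ ξ, ‖𝓕 g ξ‖ ^ 2 := by
  rw [SchwartzMap.integral_norm_sq_fourier]
  simp [h.2]

lemma norm_fourier_lineDeriv (g : 𝓢(E3, ℂ)) (l : Fin 3) (ξ : E3) :
    ‖𝓕 (∂_{(EuclideanSpace.single l 1 : E3)} g) ξ‖ = 2 * Real.pi * |ξ l| * ‖𝓕 g ξ‖ := by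
  rw [SchwartzMap.fourier_lineDerivOp_eq, smul_apply,
    SchwartzMap.smulLeftCLM_apply_apply (by fun_prop)]
  simp [EuclideanSpace.inner_single_right, abs_of_pos Real.pi_pos, mul_assoc]

lemma norm_fourier_iterate_lineDeriv (g : 𝓢(E3, ℂ)) (l : Fin 3) (n : ℕ) (ξ : E3) :
    ‖𝓕 ((fun f : 𝓢(E3, ℂ) => ∂_{(EuclideanSpace.single l 1 : E3)} f)^[n] g) ξ‖ =
      (2 * Real.pi * |ξ l|) ^ n * ‖𝓕 g ξ‖ := by
  induction n with
  | zero => simp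
  | succ n ih =>
    rw [Function.iterate_succ_apply', norm_fourier_lineDeriv, ih]
    ring

lemma integrable_norm_sq (g : 𝓢(E3, ℂ)) : Integrable fun ξ => ‖g ξ‖ ^ 2 :=
  (g.memLp 2).integrable_norm_pow (by norm_num)

/-- A monomial of degree `m` in nonnegative variables is bounded, after squaring, by the sum of
the squares of the pure powers of degree `m`. -/
lemma sq_monomial_le_sum_sq_pow {c : Fin 3 → ℝ} (hc : ∀ l, 0 ≤ c l) {m : ℕ} {b : Fin 3 → ℕ}
    (hb : b 0 + b 1 + b 2 = m) :
    (c 0 ^ b 0 * (c 1 ^ b 1 * c 2 ^ b 2)) ^ 2 ≤ ∑ l, (c l ^ m) ^ 2 := by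
  obtain ⟨k, hk⟩ := Finite.exists_max c
  calc (c 0 ^ b 0 * (c 1 ^ b 1 * c 2 ^ b 2)) ^ 2
      ≤ (c k ^ b 0 * (c k ^ b 1 * c k ^ b 2)) ^ 2 := by
        have := hc 0
        have := hc 1
        have := hc 2
        have := hc k
        gcongr <;> exact hk _
    _ = (c k ^ m) ^ 2 := by rw [← hb]; ring
    _ ≤ ∑ l, (c l ^ m) ^ 2 :=
        Finset.single_le_sum (f := fun l => (c l ^ m) ^ 2) (fun l _ => sq_nonneg _)
          (Finset.mem_univ k)

lemma integral_sq_pdMultiR_le {u : E3 → ℝ} (hu : ContDiff ℝ ∞ u) (hs : HasCompactSupport u)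
    {m : ℕ} {b : Fin 3 → ℕ} (hb : b 0 + b 1 + b 2 = m) :
    ∫ x, pdMultiR Set.univ b u x ^ 2 ≤ ∑ l : Fin 3, ∫ x, ((pdWR Set.univ l)^[m] u x) ^ 2 := by
  have hs' : HasCompactSupport (fun x => (u x : ℂ)) :=
    hs.comp_left (g := ((↑) : ℝ → ℂ)) Complex.ofReal_zero
  have hu' : ContDiff ℝ ∞ (fun x => (u x : ℂ)) := Complex.ofRealCLM.contDiff.comp hu
  have hg : Represents (hs'.toSchwartzMap hu') u := ⟨hu, fun x => rfl⟩
  rw [pdMultiR, (((hg.iterate_lineDeriv 2 (b 2)).iterate_lineDeriv 1 (b 1)).iterate_lineDeriv 0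
    (b 0)).integral_sq_eq]
  simp_rw [fun l => (hg.iterate_lineDeriv l m).integral_sq_eq]
  rw [← integral_finsetSum _ fun l _ => integrable_norm_sq _]
  refine integral_mono (integrable_norm_sq _)
    (integrable_finsetSum _ fun l _ => integrable_norm_sq _) fun ξ => ?_
  simp only [norm_fourier_iterate_lineDeriv]
  have h := sq_monomial_le_sum_sq_pow (c := fun l => 2 * Real.pi * |ξ l|)
    (fun l => by positivity) hb
  simp only [mul_pow _ ‖_‖, ← Finset.sum_mul] at h ⊢
  refine le_trans (le_of_eq ?_) (mul_le_mul_of_nonneg_right h (sq_nonneg _))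
  ring

end FourierControl

/-- mixed derivatives of order m are controlled in L² by the pure
derivatives of order m. -/
theorem mixed_derivatives_controlled
    (m : ℕ) (hm : 1 ≤ m) :
    ∃ K : ℝ, 0 < K ∧
      ∀ u : E3 → ℝ, ContDiff ℝ (⊤ : ℕ∞) u → HasCompactSupport u →
        ∑ b ∈ multiIdxEq m, ∫ x : E3, (pdMultiR Set.univ b u x) ^ 2 ≤
          K * ∑ l : Fin 3, ∫ x : E3, ((pdWR Set.univ l)^[m] u x) ^ 2 := by
  refine ⟨(multiIdxEq m).card + 1, by positivity, fun u hu hs => ?_⟩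
  have hnn : 0 ≤ ∑ l : Fin 3, ∫ x : E3, ((pdWR Set.univ l)^[m] u x) ^ 2 :=
    Finset.sum_nonneg fun l _ => integral_nonneg fun x => sq_nonneg _
  have h := Finset.sum_le_card_nsmul (multiIdxEq m)
    (fun b => ∫ x : E3, (pdMultiR Set.univ b u x) ^ 2) _
    fun b hb => integral_sq_pdMultiR_le hu hs (Finset.mem_filter.mp hb).2
  rw [nsmul_eq_mul] at h
  linarith
end
end
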